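/- arXiv:1606.01680 — 4 statements merged into one kernel-verified Lean document; each statement's English description precedes it below -/
import Mathlib

section
/- Let k, d, ℓ be positive integers with k ≥ 2, d > k and ℓ·(k−1) ≤ d−1. Let M₁, …, M_ℓ be d × d real symmetric positive-definite (in particular invertible) matrices. Then there exists a d × d real matrix A such that for every i ∈ {1, …, ℓ}, the largest eigenvalue of AᵀM_iA is strictly less than (1/k)·Tr(AᵀM_iA). -/
open Matrix

/-- The eigenvalues of a Hermitian (real symmetric) matrix, listed in decreasing order:
index `i` gives the `(i+1)`-th largest eigenvalue. For non-Hermitian matrices we return `0`. -/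
noncomputable def sortedEigs {d : ℕ} (M : Matrix (Fin d) (Fin d) ℝ) : Fin d → ℝ :=
  if h : M.IsHermitian then
    fun i => (h.eigenvalues ∘ Tuple.sort h.eigenvalues) i.rev
  else fun _ => 0

section Helpers
open scoped Matrix.Norms.L2Operator

lemma sb_norm_pos {d : ℕ} {M : Matrix (Fin d) (Fin d) ℝ} (hM : M.PosDef)
    {A : Matrix (Fin d) (Fin d) ℝ} (hA : A ≠ 0) : 0 < ‖Aᵀ * M * A‖ := by
  rw [norm_pos_iff]
  intro h
  apply hA
  apply Matrix.ext_of_mulVec_single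
  intro j
  by_contra hne
  have hx : A *ᵥ Pi.single j 1 ≠ 0 := by
    intro h0
    exact hne (by rw [h0, Matrix.zero_mulVec])
  have h1 := hM.dotProduct_mulVec_pos hx
  have h2 : star (A *ᵥ Pi.single j 1) ⬝ᵥ (M *ᵥ (A *ᵥ Pi.single j 1))
      = (Pi.single j 1) ⬝ᵥ ((Aᵀ * M * A) *ᵥ (Pi.single j (1:ℝ))) := by
    rw [star_trivial, ← Matrix.mulVec_mulVec, ← Matrix.mulVec_mulVec, Matrix.dotProduct_mulVec (Pi.single j 1) Aᵀ,
      Matrix.vecMul_transpose]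
  rw [h2, h] at h1
  simp at h1

lemma sb_exists_max {d ℓ : ℕ} (hd : 0 < d) (hl : 1 ≤ ℓ) (M : Fin ℓ → Matrix (Fin d) (Fin d) ℝ)
    (hM : ∀ i, (M i).PosDef) :
    ∃ A : Matrix (Fin d) (Fin d) ℝ, A.det ≠ 0 ∧ ∀ B : Matrix (Fin d) (Fin d) ℝ, B ≠ 0 →
      |B.det| ^ (2 * ℓ) / ∏ i, ‖Bᵀ * M i * B‖ ^ d ≤
      |A.det| ^ (2 * ℓ) / ∏ i, ‖Aᵀ * M i * A‖ ^ d := by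
  haveI : Nonempty (Fin d) := ⟨⟨0, hd⟩⟩
  haveI : ProperSpace (Matrix (Fin d) (Fin d) ℝ) := FiniteDimensional.proper ℝ _
  set g : Matrix (Fin d) (Fin d) ℝ → ℝ :=
    fun A => |A.det| ^ (2 * ℓ) / ∏ i, ‖Aᵀ * M i * A‖ ^ d with hg
  have hpos : ∀ B : Matrix (Fin d) (Fin d) ℝ, B ≠ 0 → 0 < ∏ i, ‖Bᵀ * M i * B‖ ^ d :=
    fun B hB => Finset.prod_pos fun i _ => pow_pos (sb_norm_pos (hM i) hB) _
  have hcont : ContinuousOn g (Metric.sphere 0 1) := by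
    apply ContinuousOn.div
    · exact Continuous.continuousOn (by fun_prop)
    · exact Continuous.continuousOn (by fun_prop)
    · intro A hA
      refine (hpos A ?_).ne'
      rintro rfl
      simp at hA
  have hscale : ∀ (c : ℝ) (B : Matrix (Fin d) (Fin d) ℝ), c ≠ 0 → g (c • B) = g B := by
    intro c B hc
    have e : ∀ i, ‖(c • B)ᵀ * M i * (c • B)‖ ^ d = (|c| ^ (2 * d)) * ‖Bᵀ * M i * B‖ ^ d := by
      intro i
      rw [Matrix.transpose_smul, Matrix.smul_mul, Matrix.smul_mul, Matrix.mul_smul, norm_smul,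
        norm_smul, Real.norm_eq_abs]
      ring
    simp only [hg, e, Finset.prod_mul_distrib, Finset.prod_const, Finset.card_univ,
      Fintype.card_fin, Matrix.det_smul, abs_mul, abs_pow]
    have hc' : |c| ≠ 0 := abs_ne_zero.mpr hc
    rw [mul_pow, ← pow_mul, ← pow_mul, show d * (2 * ℓ) = 2 * d * ℓ by ring]
    exact mul_div_mul_left _ _ (pow_ne_zero _ hc')
  have hne : (Metric.sphere (0 : Matrix (Fin d) (Fin d) ℝ) 1).Nonempty :=
    ⟨1, by simp⟩
  obtain ⟨A, hA, hmax⟩ := (isCompact_sphere _ _).exists_isMaxOn hne hcont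
  have hall : ∀ B : Matrix (Fin d) (Fin d) ℝ, B ≠ 0 → g B ≤ g A := by
    intro B hB
    have hn : ‖B‖ ≠ 0 := norm_ne_zero_iff.mpr hB
    rw [← hscale (‖B‖⁻¹) B (inv_ne_zero hn)]
    apply hmax
    simp [norm_smul, hn]
  refine ⟨A, ?_, hall⟩
  intro h0
  have h1 := hall 1 one_ne_zero
  have h2 : 0 < g 1 := by
    have := hpos 1 one_ne_zero
    simp only [hg, Matrix.det_one, abs_one, one_pow]
    positivity
  have : g A = 0 := by
    simp only [hg, h0, abs_zero]
    rw [zero_pow (by omega), zero_div]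
  linarith

lemma sb_shrink {d : ℕ} {N : Matrix (Fin d) (Fin d) ℝ} (hN : N.PosDef) (j₀ : Fin d)
    (hj : ∀ j, hN.isHermitian.eigenvalues j ≤ hN.isHermitian.eigenvalues j₀) :
    ∃ (c : ℝ) (B : Matrix (Fin d) (Fin d) ℝ), 0 < c ∧ c < 1 ∧ ‖B‖ ≤ 1 ∧
      B.det = c ^ (Finset.univ.filter fun j =>
        hN.isHermitian.eigenvalues j = hN.isHermitian.eigenvalues j₀).card ∧
      ‖Bᵀ * N * B‖ ≤ c ^ 2 * ‖N‖ := by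
  set lam := hN.isHermitian.eigenvalues with hlam
  have hp : ∀ j, 0 < lam j := hN.eigenvalues_pos
  set μ := lam j₀ with hμ
  have hμ0 : 0 < μ := hp j₀
  set U : Matrix (Fin d) (Fin d) ℝ := (hN.isHermitian.eigenvectorUnitary : Matrix (Fin d) (Fin d) ℝ) with hU
  have hUm := hN.isHermitian.eigenvectorUnitary.2
  have hU1 : star U * U = 1 := (Unitary.mem_iff.mp hUm).1
  have hspec : N = U * diagonal lam * star U := by
    have := hN.isHermitian.spectral_theorem
    rw [Unitary.conjStarAlgAut_apply] at this
    simpa using this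
  have hconj : ∀ v : Fin d → ℝ, ‖U * diagonal v * star U‖ = ‖v‖ := by
    intro v
    have e1 : ‖U * diagonal v * star U‖ = ‖U * diagonal v‖ :=
      CStarRing.norm_mul_mem_unitary _ (Unitary.star_mem hUm)
    have e2 : ‖U * diagonal v‖ = ‖diagonal v‖ :=
      CStarRing.norm_mem_unitary_mul _ hUm
    rw [e1, e2, l2_opNorm_diagonal]
  -- choose c
  have hc : ∃ c : ℝ, 0 < c ∧ c < 1 ∧ ∀ j, lam j ≠ μ → lam j ≤ c ^ 2 * μ := by
    have hev : ∀ᶠ c in nhdsWithin (1:ℝ) (Set.Iio 1), 0 < c ∧ c < 1 ∧ ∀ j, lam j ≠ μ → lam j ≤ c ^ 2 * μ := by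
      refine Filter.Eventually.and ?_ (Filter.Eventually.and ?_ ?_)
      · exact nhdsWithin_le_nhds (lt_mem_nhds one_pos)
      · exact self_mem_nhdsWithin
      · rw [Filter.eventually_all]
        intro j
        by_cases h : lam j = μ
        · simp [h]
        · have hlt : lam j < μ := lt_of_le_of_ne (hj j) h
          have ht : Filter.Tendsto (fun c : ℝ => c ^ 2 * μ) (nhds 1) (nhds (1 ^ 2 * μ)) :=
            Continuous.tendsto (by fun_prop) 1
          have := nhdsWithin_le_nhds (s := Set.Iio (1:ℝ)) (ht.eventually (lt_mem_nhds (by simpa using hlt)))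
          filter_upwards [this] with c hc _
          exact hc.le
    exact hev.exists
  obtain ⟨c, hc0, hc1, hcj⟩ := hc
  set b : Fin d → ℝ := fun j => if lam j = μ then c else 1 with hb
  have hBt : (U * diagonal b * star U)ᵀ = U * diagonal b * star U := by
    rw [← conjTranspose_eq_transpose_of_trivial, ← star_eq_conjTranspose, star_mul, star_mul,
      star_star, mul_assoc, star_eq_conjTranspose (diagonal b), diagonal_conjTranspose, star_trivial]
  refine ⟨c, U * diagonal b * star U, hc0, hc1, ?_, ?_, ?_⟩
  · rw [hconj, pi_norm_le_iff_of_nonneg zero_le_one]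
    intro j
    simp only [hb]
    split_ifs <;> simp [abs_of_pos hc0, hc1.le]
  · rw [det_mul, det_mul, det_diagonal, mul_right_comm, ← det_mul, (Unitary.mem_iff.mp hUm).2,
      det_one, one_mul]
    simp [hb, Finset.prod_ite]
  · rw [hBt]
    have : U * diagonal b * star U * N * (U * diagonal b * star U)
        = U * diagonal (fun j => b j * lam j * b j) * star U := by
      rw [← diagonal_mul_diagonal, ← diagonal_mul_diagonal]
      calc _ = U * diagonal b * (star U * U) * diagonal lam * (star U * U) * diagonal b * star U := by
            conv_lhs => rw [hspec]
            simp only [mul_assoc]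
        _ = _ := by rw [hU1]; simp only [mul_assoc, one_mul, mul_one]
    rw [this, hconj]
    have hNn : μ ≤ ‖N‖ := by
      rw [hspec, hconj]
      exact (le_abs_self _).trans (norm_le_pi_norm lam j₀)
    refine le_trans ?_ (mul_le_mul_of_nonneg_left hNn (sq_nonneg c))
    rw [pi_norm_le_iff_of_nonneg (by positivity)]
    intro j
    have hbn : 0 ≤ b j := by simp only [hb]; split_ifs <;> positivity
    have := hp j
    rw [Real.norm_eq_abs, abs_of_nonneg (by positivity)]
    simp only [hb]
    split_ifs with h
    · rw [h]; apply le_of_eq; ring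
    · simpa using hcj j h

lemma sb_mult {d ℓ : ℕ} (M : Fin ℓ → Matrix (Fin d) (Fin d) ℝ)
    (hM : ∀ i, (M i).PosDef) (A : Matrix (Fin d) (Fin d) ℝ) (hA : A.det ≠ 0) (hd : 0 < d)
    (hmax : ∀ B : Matrix (Fin d) (Fin d) ℝ, B ≠ 0 →
      |B.det| ^ (2 * ℓ) / ∏ i, ‖Bᵀ * M i * B‖ ^ d ≤
      |A.det| ^ (2 * ℓ) / ∏ i, ‖Aᵀ * M i * A‖ ^ d) (i : Fin ℓ)
    (hN : (Aᵀ * M i * A).PosDef) (j₀ : Fin d)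
    (hj : ∀ j, hN.isHermitian.eigenvalues j ≤ hN.isHermitian.eigenvalues j₀) :
    d ≤ ℓ * (Finset.univ.filter fun j =>
        hN.isHermitian.eigenvalues j = hN.isHermitian.eigenvalues j₀).card := by
  haveI : Nonempty (Fin d) := ⟨⟨0, hd⟩⟩
  obtain ⟨c, B, hc0, hc1, hB1, hBdet, hBN⟩ := sb_shrink hN j₀ hj
  set r := (Finset.univ.filter fun j =>
        hN.isHermitian.eigenvalues j = hN.isHermitian.eigenvalues j₀).card
  have hdetne : (A * B).det ≠ 0 := by
    rw [det_mul, hBdet]; exact mul_ne_zero hA (pow_ne_zero _ hc0.ne')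
  have hne0 : ∀ X : Matrix (Fin d) (Fin d) ℝ, X.det ≠ 0 → X ≠ 0 := by
    rintro X hX rfl
    exact hX det_zero
  have hpos : ∀ X : Matrix (Fin d) (Fin d) ℝ, X ≠ 0 → 0 < ∏ i, ‖Xᵀ * M i * X‖ ^ d :=
    fun X hX => Finset.prod_pos fun i _ => pow_pos (sb_norm_pos (hM i) hX) _
  have h := hmax (A * B) (hne0 _ hdetne)
  rw [div_le_div_iff₀ (hpos _ (hne0 _ hdetne)) (hpos _ (hne0 _ hA))] at h
  have hle : ∏ m, ‖(A * B)ᵀ * M m * (A * B)‖ ^ d ≤ c ^ (2 * d) * ∏ m, ‖Aᵀ * M m * A‖ ^ d := by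
    have e : c ^ (2 * d) = ∏ m : Fin ℓ, (if m = i then c ^ (2 * d) else 1) := by simp
    rw [e, ← Finset.prod_mul_distrib]
    apply Finset.prod_le_prod (fun _ _ => by positivity)
    intro m _
    have e2 : (A * B)ᵀ * M m * (A * B) = Bᵀ * (Aᵀ * M m * A) * B := by
      rw [transpose_mul]; simp only [mul_assoc]
    rw [e2]
    split_ifs with hm
    · subst hm
      rw [pow_mul, ← mul_pow]
      exact pow_le_pow_left₀ (norm_nonneg _) hBN _
    · rw [one_mul]
      apply pow_le_pow_left₀ (norm_nonneg _)
      have hBt : ‖Bᵀ‖ ≤ 1 := by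
        rw [← conjTranspose_eq_transpose_of_trivial, l2_opNorm_conjTranspose]; exact hB1
      calc ‖Bᵀ * (Aᵀ * M m * A) * B‖ ≤ ‖Bᵀ * (Aᵀ * M m * A)‖ * ‖B‖ := norm_mul_le _ _
        _ ≤ (‖Bᵀ‖ * ‖Aᵀ * M m * A‖) * ‖B‖ := by gcongr; exact norm_mul_le _ _
        _ ≤ (1 * ‖Aᵀ * M m * A‖) * 1 := by gcongr
        _ = _ := by ring
  have hA' : 0 < |A.det| ^ (2 * ℓ) := by positivity
  have h2 := h.trans (mul_le_mul_of_nonneg_left hle hA'.le)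
  rw [det_mul, hBdet, abs_mul, abs_of_pos (pow_pos hc0 r), mul_pow, mul_assoc] at h2
  have h3 := le_of_mul_le_mul_left h2 hA'
  have h4 := le_of_mul_le_mul_right h3 (hpos _ (hne0 _ hA))
  rw [← pow_mul, pow_le_pow_iff_right_of_lt_one₀ hc0 hc1] at h4
  nlinarith

end Helpers

/-- Any `ℓ` symmetric positive-definite `d × d` matrices can be simultaneously
spectrally balanced: if `k ≥ 2`, `d > k` and `ℓ·(k−1) ≤ d−1`, there is a matrix `A` so that for
each `i` the largest eigenvalue of `AᵀM_iA` is less than `(1/k)·Tr(AᵀM_iA)`. -/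
theorem stmt0 (k d ℓ : ℕ) (hk : 2 ≤ k) (hdk : k < d) (hℓ : 1 ≤ ℓ)
    (hℓk : ℓ * (k - 1) ≤ d - 1)
    (M : Fin ℓ → Matrix (Fin d) (Fin d) ℝ) (hM : ∀ i, (M i).PosDef) :
    ∃ A : Matrix (Fin d) (Fin d) ℝ, ∀ i : Fin ℓ,
      sortedEigs (Aᵀ * M i * A) ⟨0, by omega⟩
        < (1 / (k : ℝ)) * Matrix.trace (Aᵀ * M i * A) := by
  obtain ⟨A, hA, hmax⟩ := sb_exists_max (by omega) hℓ M hM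
  refine ⟨A, fun i => ?_⟩
  have hN : (Aᵀ * M i * A).PosDef := by
    rw [← conjTranspose_eq_transpose_of_trivial]
    exact (hM i).conjTranspose_mul_mul_same
      (Matrix.mulVec_injective_iff_isUnit.mpr ((isUnit_iff_isUnit_det _).mpr (isUnit_iff_ne_zero.mpr hA)))
  set lam := hN.isHermitian.eigenvalues with hlam
  have hp : ∀ j, 0 < lam j := hN.eigenvalues_pos
  set j₀ : Fin d := Tuple.sort lam (Fin.rev ⟨0, by omega⟩) with hj₀
  have hs : sortedEigs (Aᵀ * M i * A) ⟨0, by omega⟩ = lam j₀ := by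
    unfold sortedEigs
    rw [dif_pos hN.isHermitian]
    rfl
  have hj : ∀ j, lam j ≤ lam j₀ := by
    intro j
    have := Tuple.monotone_sort lam (a := (Tuple.sort lam).symm j) (b := Fin.rev ⟨0, by omega⟩)
      (by rw [Fin.le_def, Fin.val_rev]; simp; omega)
    simpa using this
  have hr := sb_mult M hM A hA (by omega) hmax i hN j₀ hj
  rw [hs, hN.isHermitian.trace_eq_sum_eigenvalues]
  simp only [RCLike.ofReal_real_eq_id, id]
  rw [← hlam] at hr ⊢
  set T := Finset.univ.filter fun j => lam j = lam j₀ with hT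
  have hkr : k ≤ T.card := by
    by_contra hlt
    have : ℓ * T.card ≤ ℓ * (k - 1) := Nat.mul_le_mul_left _ (by omega)
    omega
  have hsumT : ∑ j ∈ T, lam j = T.card * lam j₀ := by
    rw [Finset.sum_congr rfl (fun j hj => (Finset.mem_filter.mp hj).2),
      Finset.sum_const, nsmul_eq_mul]
  have hk0 : (0:ℝ) < k := by positivity
  have hmain : (k:ℝ) * lam j₀ < ∑ j, lam j := by
    have hkr' : (k:ℝ) ≤ T.card := by exact_mod_cast hkr
    have h1 : (k:ℝ) * lam j₀ ≤ ∑ j ∈ T, lam j := by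
      rw [hsumT]; exact mul_le_mul_of_nonneg_right hkr' (hp j₀).le
    by_cases hTu : T = Finset.univ
    · rw [← hTu, hsumT]
      have : T.card = d := by rw [hTu]; simp
      rw [this]
      exact mul_lt_mul_of_pos_right (by exact_mod_cast hdk) (hp j₀)
    · obtain ⟨x, hx⟩ : ∃ x, x ∉ T := by
        by_contra hcon
        push Not at hcon
        exact hTu (Finset.eq_univ_iff_forall.mpr hcon)
      exact lt_of_le_of_lt h1 (Finset.sum_lt_sum_of_subset (Finset.subset_univ T)
        (Finset.mem_univ x) hx (hp x) (fun j _ _ => (hp j).le))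
  rw [one_div, lt_inv_mul_iff₀ hk0]
  exact hmain
end

section
/- Let B be a d × d real symmetric positive-definite matrix with eigenvalues λ₁ ≥ λ₂ ≥ … ≥ λ_d (counted with multiplicity), and for each j let E_j be the eigenspace of B corresponding to λ_j. Let η ∈ ℝᵈ and define B(ε) = (Id + ε η⊗η)ᵀ B (Id + ε η⊗η). Then there exists ε₀ > 0 such that for every index j ∈ {2, …, d} with E_{j−1} = E_j (i.e. λ_{j−1} = λ_j), one has λ_j(B(ε)) = λ_j for all ε ∈ (0, ε₀), where λ_j(B(ε)) denotes the j-th largest eigenvalue of B(ε). -/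
open Matrix

lemma dot_self_nonneg' {d : ℕ} (x : Fin d → ℝ) : 0 ≤ x ⬝ᵥ x :=
  Finset.sum_nonneg fun i _ => mul_self_nonneg (x i)

/-- Diagonalization with sorted eigenvalues. -/
lemma sorted_diag {d : ℕ} (M : Matrix (Fin d) (Fin d) ℝ) (h : M.IsHermitian) :
    Antitone (sortedEigs M) ∧ ∃ φ : Fin d → ((Fin d → ℝ) →ₗ[ℝ] ℝ),
      (∀ x, x ⬝ᵥ x = ∑ i, (φ i x) ^ 2) ∧
      (∀ x, x ⬝ᵥ (M *ᵥ x) = ∑ i, sortedEigs M i * (φ i x) ^ 2) := by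
  have hs : sortedEigs M = fun i => (h.eigenvalues ∘ Tuple.sort h.eigenvalues) i.rev := by
    exact dif_pos h
  constructor
  · rw [hs]
    intro a b hab
    exact Tuple.monotone_sort h.eigenvalues (Fin.rev_le_rev.mpr hab)
  set U : Matrix (Fin d) (Fin d) ℝ := (h.eigenvectorUnitary).1 with hU
  have hUU : U * Uᵀ = 1 := by
    have := Unitary.coe_mul_star_self h.eigenvectorUnitary
    simpa [star_eq_conjTranspose, hU] using this
  have hM : M = U * diagonal h.eigenvalues * Uᵀ := by
    have := h.spectral_theorem
    rw [Unitary.conjStarAlgAut_apply] at this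
    simpa [star_eq_conjTranspose, hU, Function.comp_def] using! this
  let σ : Fin d ≃ Fin d := Fin.revPerm.trans (Tuple.sort h.eigenvalues)
  refine ⟨fun i => (LinearMap.proj (σ i)).comp (Uᵀ).mulVecLin, fun x => ?_, fun x => ?_⟩
  · have e : ∑ i, ((Uᵀ *ᵥ x) (σ i)) ^ 2 = ∑ i, ((Uᵀ *ᵥ x) i) ^ 2 :=
      Equiv.sum_comp σ (fun i => ((Uᵀ *ᵥ x) i) ^ 2)
    have e2 : ∑ i, ((Uᵀ *ᵥ x) i) ^ 2 = (Uᵀ *ᵥ x) ⬝ᵥ (Uᵀ *ᵥ x) := by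
      simp [dotProduct, sq]
    simp only [LinearMap.comp_apply, LinearMap.proj_apply, mulVecLin_apply]
    rw [e, e2, dotProduct_mulVec, vecMul_transpose, mulVec_mulVec, hUU, one_mulVec]
  · have e : ∑ i, h.eigenvalues (σ i) * ((Uᵀ *ᵥ x) (σ i)) ^ 2
        = ∑ i, h.eigenvalues i * ((Uᵀ *ᵥ x) i) ^ 2 :=
      Equiv.sum_comp σ (fun i => h.eigenvalues i * ((Uᵀ *ᵥ x) i) ^ 2)
    have e2 : ∑ i, h.eigenvalues i * ((Uᵀ *ᵥ x) i) ^ 2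
        = (Uᵀ *ᵥ x) ⬝ᵥ (diagonal h.eigenvalues *ᵥ (Uᵀ *ᵥ x)) := by
      simp only [dotProduct, mulVec_diagonal]
      exact Finset.sum_congr rfl fun i _ => by ring
    have e3 : ∀ i, sortedEigs M i = h.eigenvalues (σ i) := by
      intro i; rw [hs]; rfl
    simp only [LinearMap.comp_apply, LinearMap.proj_apply, mulVecLin_apply, e3]
    rw [e, e2, mulVec_transpose, ← dotProduct_mulVec, mulVec_mulVec, ← mulVec_transpose,
      mulVec_mulVec, ← hM]

lemma exists_common_zero {d : ℕ} (f : Fin d → ((Fin d → ℝ) →ₗ[ℝ] ℝ)) (m : Fin d)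
    (hm : f m = 0) : ∃ y : Fin d → ℝ, y ≠ 0 ∧ ∀ i, f i y = 0 := by
  by_contra hcon
  push Not at hcon
  have hinj : Function.Injective (LinearMap.pi f) := by
    rw [← LinearMap.ker_eq_bot, LinearMap.ker_eq_bot']
    intro y hy
    by_contra hne
    obtain ⟨i, hi⟩ := hcon y hne
    exact hi (congrFun hy i)
  obtain ⟨y, hy⟩ := (LinearMap.injective_iff_surjective.mp hinj) (fun _ => 1)
  have := congrFun hy m
  simp [hm] at this

theorem stmt7 (d : ℕ) (B : Matrix (Fin d) (Fin d) ℝ) (hB : B.PosDef) (η : Fin d → ℝ) :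
    ∃ ε₀ > (0 : ℝ), ∀ j i : Fin d, i.val + 1 = j.val →
      sortedEigs B i = sortedEigs B j →
      ∀ ε : ℝ, 0 < ε → ε < ε₀ →
        sortedEigs ((1 + ε • vecMulVec η η)ᵀ * B * (1 + ε • vecMulVec η η)) j
          = sortedEigs B j := by
  refine ⟨1, one_pos, fun j i hij hl ε hε _ => ?_⟩
  set S : Matrix (Fin d) (Fin d) ℝ := 1 + ε • vecMulVec η η with hS
  have hMh : (Sᵀ * B * S).IsHermitian := by
    have := isHermitian_conjTranspose_mul_mul S hB.isHermitian
    simpa using this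
  set M := Sᵀ * B * S with hMdef
  have hSx : ∀ x, S *ᵥ x = x + (ε * (η ⬝ᵥ x)) • η := by
    intro x
    rw [hS, add_mulVec, one_mulVec, smul_mulVec, vecMulVec_mulVec]
    ext k
    simp; ring
  have hq : ∀ x, x ⬝ᵥ (M *ᵥ x) = (S *ᵥ x) ⬝ᵥ (B *ᵥ (S *ᵥ x)) := by
    intro x
    rw [hMdef, ← mulVec_mulVec, ← mulVec_mulVec, dotProduct_mulVec, vecMul_transpose]
  have hSge : ∀ x, x ⬝ᵥ x ≤ (S *ᵥ x) ⬝ᵥ (S *ᵥ x) := by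
    intro x
    rw [hSx]
    simp only [add_dotProduct, dotProduct_add, smul_dotProduct, dotProduct_smul, smul_eq_mul,
      dotProduct_comm x η]
    have h1 : 0 ≤ η ⬝ᵥ η := dot_self_nonneg' η
    have h2 : 0 ≤ ε * (η ⬝ᵥ x) * (η ⬝ᵥ x) := by
      rw [mul_assoc]; exact mul_nonneg hε.le (mul_self_nonneg _)
    have h3 : 0 ≤ ε * (η ⬝ᵥ x) * (ε * (η ⬝ᵥ x) * (η ⬝ᵥ η)) := by
      rw [← mul_assoc]; exact mul_nonneg (mul_self_nonneg _) h1
    linarith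
  have hpos : 0 ≤ sortedEigs B j := by
    simp only [sortedEigs, hB.isHermitian, dif_pos]
    exact (hB.eigenvalues_pos _).le
  obtain ⟨haB, φ, hφ1, hφ2⟩ := sorted_diag B hB.isHermitian
  obtain ⟨haM, ψ, hψ1, hψ2⟩ := sorted_diag M hMh
  have hypos : ∀ y : Fin d → ℝ, y ≠ 0 → 0 < y ⬝ᵥ y := fun y hy =>
    lt_of_le_of_ne (dot_self_nonneg' y) (fun h => hy (dotProduct_self_eq_zero.mp h.symm))
  apply le_antisymm
  · obtain ⟨y, hy, hf⟩ := exists_common_zero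
      (fun k => if k < i then φ k else if k = i then dotProductBilin ℝ ℝ η
        else if k = j then 0 else ψ k) j (by
          have h1 : ¬ j < i := by rw [Fin.lt_def]; omega
          have h2 : ¬ j = i := by rw [Fin.ext_iff]; omega
          simp [h1, h2])
    have hη : η ⬝ᵥ y = 0 := by
      have := hf i
      simpa using this
    have hSy : S *ᵥ y = y := by rw [hSx, hη]; simp
    have h1 : sortedEigs M j * (y ⬝ᵥ y) ≤ y ⬝ᵥ (M *ᵥ y) := by
      rw [hψ1, hψ2, Finset.mul_sum]
      refine Finset.sum_le_sum fun k _ => ?_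
      rcases le_or_gt k j with hk | hk
      · exact mul_le_mul_of_nonneg_right (haM hk) (sq_nonneg _)
      · have := hf k
        have a1 : ¬ k < i := by rw [Fin.lt_def] at *; omega
        have a2 : ¬ k = i := by rw [Fin.ext_iff]; rw [Fin.lt_def] at *; omega
        have a3 : ¬ k = j := hk.ne'
        simp only [a1, a2, a3, if_false] at this
        simp [this]
    have h2 : y ⬝ᵥ (B *ᵥ y) ≤ sortedEigs B i * (y ⬝ᵥ y) := by
      rw [hφ1, hφ2, Finset.mul_sum]
      refine Finset.sum_le_sum fun k _ => ?_
      rcases le_or_gt i k with hk | hk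
      · exact mul_le_mul_of_nonneg_right (haB hk) (sq_nonneg _)
      · have := hf k
        simp only [hk, if_true] at this
        simp [this]
    rw [hq, hSy] at h1
    rw [← hl]
    exact le_of_mul_le_mul_right (h1.trans h2) (hypos y hy)
  · obtain ⟨y, hy, hf⟩ := exists_common_zero
      (fun k => if k < j then ψ k else if k = j then 0 else (φ k).comp S.mulVecLin) j (by simp)
    have h1 : y ⬝ᵥ (M *ᵥ y) ≤ sortedEigs M j * (y ⬝ᵥ y) := by
      rw [hψ1, hψ2, Finset.mul_sum]
      refine Finset.sum_le_sum fun k _ => ?_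
      rcases le_or_gt j k with hk | hk
      · exact mul_le_mul_of_nonneg_right (haM hk) (sq_nonneg _)
      · have := hf k
        simp only [hk, if_true] at this
        simp [this]
    have h2 : sortedEigs B j * ((S *ᵥ y) ⬝ᵥ (S *ᵥ y)) ≤ (S *ᵥ y) ⬝ᵥ (B *ᵥ (S *ᵥ y)) := by
      rw [hφ1, hφ2, Finset.mul_sum]
      refine Finset.sum_le_sum fun k _ => ?_
      rcases le_or_gt k j with hk | hk
      · exact mul_le_mul_of_nonneg_right (haB hk) (sq_nonneg _)
      · have := hf k
        simp only [hk.not_gt, hk.ne', if_false, LinearMap.comp_apply, mulVecLin_apply] at this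
        simp [this]
    rw [hq] at h1
    have h3 := mul_le_mul_of_nonneg_left (hSge y) hpos
    exact le_of_mul_le_mul_right (h3.trans (h2.trans h1)) (hypos y hy)
end

section
/- Let ℓ ≥ 1 and let μ₁, …, μ_ℓ be centered probability measures on ℝᵈ with finite second moments and non-singular covariance matrices. Then there exists a constant C > 0 with the following property: for every adaptive random walk (X_t)_{t ≥ 0} using μ₁, …, μ_ℓ, every R > C, every x ∈ ℝᵈ and every δ > 0, P( x + X_t ∈ B(0,R) for every integer t with 1 ≤ t ≤ R^{2+δ} ) ≤ C·exp(−R^{δ}/C), where B(0,R) is the closed Euclidean ball of radius R centered at the origin. -/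
open MeasureTheory Matrix
open scoped ProbabilityTheory

/-- A process `X` is an *adaptive random walk* using the measures `μ 0, …, μ (ℓ-1)` (with index
process `I` and filtration `F`, given as a monotone family of sub-σ-algebras of the ambient
σ-algebra) if `X` and `I` are adapted to `F` and, for every `t`, the conditional distribution of
the increment `X (t+1) − X t` given `F t` is `μ (I t ·)` almost surely (expressed via
conditional expectations of indicators of measurable sets). -/
structure IsAdaptiveWalk {Ω : Type} [MeasureSpace Ω] {d ℓ : ℕ}
    (F : ℕ → MeasurableSpace Ω)
    (X : ℕ → Ω → EuclideanSpace ℝ (Fin d))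
    (I : ℕ → Ω → Fin ℓ)
    (μ : Fin ℓ → Measure (EuclideanSpace ℝ (Fin d))) : Prop where
  le : ∀ t, F t ≤ (inferInstance : MeasurableSpace Ω)
  mono : Monotone F
  adaptedX : ∀ t, Measurable[F t] (X t)
  adaptedI : ∀ t, Measurable[F t] (I t)
  cond : ∀ (t : ℕ) (s : Set (EuclideanSpace ℝ (Fin d))), MeasurableSet s →
    (ℙ[fun ω => s.indicator (fun _ => (1 : ℝ)) (X (t + 1) ω - X t ω)|F t])
      =ᵐ[ℙ] fun ω => (μ (I t ω) s).toReal

open Filter Topology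
open scoped ENNReal

/-- The quadratic Lyapunov function. -/
noncomputable def lyap {d : ℕ} (R : ℝ) (w : EuclideanSpace ℝ (Fin d)) : ℝ := 2 - ‖w‖ ^ 2 / R ^ 2

/-- The Lyapunov function killed outside of the ball. -/
noncomputable def klyap {d : ℕ} (R : ℝ) (w : EuclideanSpace ℝ (Fin d)) : ℝ :=
  (Metric.closedBall (0 : EuclideanSpace ℝ (Fin d)) R).indicator (lyap R) w

lemma measurable_lyap {d : ℕ} (R : ℝ) : Measurable (lyap (d := d) R) := by
  unfold lyap; fun_prop

lemma measurable_klyap {d : ℕ} (R : ℝ) : Measurable (klyap (d := d) R) := by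
  unfold klyap
  exact (measurable_lyap R).indicator Metric.isClosed_closedBall.measurableSet

lemma one_le_lyap {d : ℕ} {R : ℝ} (hR : 0 < R) {w : EuclideanSpace ℝ (Fin d)} (hw : ‖w‖ ≤ R) :
    1 ≤ lyap R w := by
  unfold lyap
  have : ‖w‖ ^ 2 / R ^ 2 ≤ 1 := by
    rw [div_le_one (by positivity)]
    gcongr
  linarith

lemma lyap_le_two {d : ℕ} (R : ℝ) (w : EuclideanSpace ℝ (Fin d)) :
    lyap R w ≤ 2 := by
  unfold lyap
  have : 0 ≤ ‖w‖ ^ 2 / R ^ 2 := by positivity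
  linarith

lemma klyap_nonneg {d : ℕ} {R : ℝ} (hR : 0 < R) (w : EuclideanSpace ℝ (Fin d)) :
    0 ≤ klyap R w := by
  unfold klyap
  apply Set.indicator_nonneg
  intro w hw
  have := one_le_lyap hR (mem_closedBall_zero_iff.1 hw)
  linarith

lemma klyap_bound {d : ℕ} {R : ℝ} (hR : 0 < R) (z y : EuclideanSpace ℝ (Fin d)) (hz : ‖z‖ ≤ R) :
    klyap R (z + y) ≤ lyap R z - (2 * inner ℝ z y + ‖y‖ ^ 2) / R ^ 2
      + 25 / R ^ 2 * ({y : EuclideanSpace ℝ (Fin d) | R / 4 ≤ ‖y‖}.indicator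
          (fun y => ‖y‖ ^ 2) y) := by
  have hexp : lyap R z - (2 * inner ℝ z y + ‖y‖ ^ 2) / R ^ 2 = lyap R (z + y) := by
    unfold lyap
    rw [norm_add_sq_real]
    ring
  rw [hexp]
  have hR2 : 0 < R ^ 2 := by positivity
  have hind : 0 ≤ ({y : EuclideanSpace ℝ (Fin d) | R / 4 ≤ ‖y‖}.indicator
          (fun y => ‖y‖ ^ 2) y) := Set.indicator_nonneg (fun _ _ => by positivity) _
  have htri : ‖z + y‖ ≤ ‖z‖ + ‖y‖ := norm_add_le z y
  by_cases hy : R / 4 ≤ ‖y‖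
  · rw [Set.indicator_of_mem (by exact hy)]
    unfold klyap
    by_cases hw : z + y ∈ Metric.closedBall (0 : EuclideanSpace ℝ (Fin d)) R
    · rw [Set.indicator_of_mem hw]
      have : 0 ≤ 25 / R ^ 2 * ‖y‖ ^ 2 := by positivity
      linarith
    · rw [Set.indicator_of_notMem hw]
      unfold lyap
      have h5 : ‖z + y‖ ^ 2 ≤ 25 * ‖y‖ ^ 2 := by
        have : ‖z + y‖ ≤ 5 * ‖y‖ := by linarith
        calc ‖z + y‖ ^ 2 ≤ (5 * ‖y‖) ^ 2 := by gcongr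
          _ = _ := by ring
      have : ‖z + y‖ ^ 2 / R ^ 2 ≤ 25 * ‖y‖ ^ 2 / R ^ 2 := by gcongr
      have h6 : 25 / R ^ 2 * ‖y‖ ^ 2 = 25 * ‖y‖ ^ 2 / R ^ 2 := by ring
      linarith
  · have h2 : klyap R (z + y) ≤ lyap R (z + y) := by
      unfold klyap
      by_cases hw : z + y ∈ Metric.closedBall (0 : EuclideanSpace ℝ (Fin d)) R
      · rw [Set.indicator_of_mem hw]
      · rw [Set.indicator_of_notMem hw]
        unfold lyap
        have h5 : ‖z + y‖ ^ 2 / R ^ 2 ≤ 2 := by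
          rw [div_le_iff₀ hR2]
          have : ‖z + y‖ ≤ 5 / 4 * R := by linarith
          calc ‖z + y‖ ^ 2 ≤ (5 / 4 * R) ^ 2 := by gcongr
            _ ≤ _ := by nlinarith
        linarith
    have : 0 ≤ 25 / R ^ 2 * ({y : EuclideanSpace ℝ (Fin d) | R / 4 ≤ ‖y‖}.indicator
          (fun y => ‖y‖ ^ 2) y) := by positivity
    linarith

lemma integrable_id_of_sq {d : ℕ} (μ : Measure (EuclideanSpace ℝ (Fin d)))
    [IsProbabilityMeasure μ] (hmom : Integrable (fun y => ‖y‖ ^ 2) μ) :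
    Integrable (fun y => y) μ := by
  have : MemLp (fun y : EuclideanSpace ℝ (Fin d) => y) 2 μ :=
    (memLp_two_iff_integrable_sq_norm (by fun_prop)).2 hmom
  exact this.integrable (by norm_num)

/-- One-step estimate. -/
lemma one_step {d : ℕ} (μ : Measure (EuclideanSpace ℝ (Fin d)))
    [IsProbabilityMeasure μ] (hcent : ∫ y, y ∂μ = 0) (hmom : Integrable (fun y => ‖y‖ ^ 2) μ)
    {c R : ℝ} (hc : 0 < c) (hR : 0 < R) (hm : 4 * c ≤ ∫ y, ‖y‖ ^ 2 ∂μ)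
    (htail : 25 * ∫ y, ({y : EuclideanSpace ℝ (Fin d) | R / 4 ≤ ‖y‖}.indicator
          (fun y => ‖y‖ ^ 2) y) ∂μ ≤ 2 * c)
    (z : EuclideanSpace ℝ (Fin d)) (hz : ‖z‖ ≤ R) :
    ∫⁻ y, ENNReal.ofReal (klyap R (z + y)) ∂μ ≤ ENNReal.ofReal ((1 - c / R ^ 2) * lyap R z) := by
  have hid := integrable_id_of_sq μ hmom
  have hS : MeasurableSet {y : EuclideanSpace ℝ (Fin d) | R / 4 ≤ ‖y‖} :=
    measurableSet_le measurable_const measurable_norm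
  have hind := hmom.indicator hS
  have hin : Integrable (fun y => inner ℝ z y) μ := hid.const_inner z
  have hin0 : ∫ y, inner ℝ z y ∂μ = 0 := by
    rw [integral_inner hid, hcent, inner_zero_right]
  have hmeas : Measurable (fun y => klyap R (z + y)) :=
    (measurable_klyap R).comp (measurable_const_add z)
  have hI1 : Integrable (fun y => (2 * inner ℝ z y + ‖y‖ ^ 2) / R ^ 2) μ :=
    ((hin.const_mul 2).add hmom).div_const _
  have hI2 : Integrable (fun y => lyap R z - (2 * inner ℝ z y + ‖y‖ ^ 2) / R ^ 2) μ :=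
    (integrable_const _).sub hI1
  have hI3 : Integrable (fun y => 25 / R ^ 2 * ({y : EuclideanSpace ℝ (Fin d) |
      R / 4 ≤ ‖y‖}.indicator (fun y => ‖y‖ ^ 2) y)) μ := hind.const_mul _
  have hRHS := hI2.add hI3
  have hK : Integrable (fun y => klyap R (z + y)) μ := by
    refine hRHS.mono' hmeas.aestronglyMeasurable (ae_of_all _ fun y => ?_)
    rw [Real.norm_of_nonneg (klyap_nonneg hR _)]
    exact klyap_bound hR z y hz
  rw [← ofReal_integral_eq_lintegral_ofReal hK (ae_of_all _ fun y => klyap_nonneg hR _)]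
  apply ENNReal.ofReal_le_ofReal
  have h1 := integral_mono hK hRHS (fun y => klyap_bound hR z y hz)
  refine h1.trans ?_
  have h2 : ∫ y, (lyap R z - (2 * inner ℝ z y + ‖y‖ ^ 2) / R ^ 2) ∂μ
      = lyap R z - (∫ y, ‖y‖ ^ 2 ∂μ) / R ^ 2 := by
    rw [integral_sub (integrable_const _) hI1, integral_div,
      integral_add (hin.const_mul 2) hmom, integral_const_mul, hin0]
    simp
  have h3 := integral_add hI2 hI3
  rw [h2, integral_const_mul] at h3
  refine (le_of_eq h3).trans ?_
  have hu := lyap_le_two R z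
  have hR2 : 0 < R ^ 2 := by positivity
  have e1 : 4 * c / R ^ 2 ≤ (∫ y, ‖y‖ ^ 2 ∂μ) / R ^ 2 := by gcongr
  have e2 := div_le_div_of_nonneg_right htail hR2.le
  have e3 : c / R ^ 2 * lyap R z ≤ c / R ^ 2 * 2 := by gcongr
  have e4 : ∀ T : ℝ, 25 * T / R ^ 2 = 25 / R ^ 2 * T := fun T => by ring
  rw [e4] at e2
  have e5 : 4 * c / R ^ 2 = 4 * (c / R ^ 2) := by ring
  have e6 : 2 * c / R ^ 2 = 2 * (c / R ^ 2) := by ring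
  rw [e5] at e1
  rw [e6] at e2
  linarith

lemma second_moment_pos {d : ℕ} (hd : 1 ≤ d) (μ : Measure (EuclideanSpace ℝ (Fin d)))
    (hmom : Integrable (fun y => ‖y‖ ^ 2) μ)
    (hcov : IsUnit (Matrix.of fun a b : Fin d => ∫ y, y a * y b ∂μ)) :
    0 < ∫ y, ‖y‖ ^ 2 ∂μ := by
  refine lt_of_le_of_ne (integral_nonneg fun y => by positivity) fun h => ?_
  have h0 := (integral_eq_zero_iff_of_nonneg (fun y => by positivity) hmom).1 h.symm
  have hz : (Matrix.of fun a b : Fin d => ∫ y, y a * y b ∂μ) = 0 := by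
    ext a b
    simp only [Matrix.of_apply, Matrix.zero_apply]
    apply integral_eq_zero_of_ae
    filter_upwards [h0] with y hy
    have : y = 0 := by simpa using hy
    simp [this]
  rw [hz] at hcov
  haveI : Nonempty (Fin d) := ⟨⟨0, hd⟩⟩
  exact not_isUnit_zero hcov

lemma tail_tendsto {d : ℕ} (μ : Measure (EuclideanSpace ℝ (Fin d)))
    (hmom : Integrable (fun y => ‖y‖ ^ 2) μ) :
    Tendsto (fun R : ℝ => 25 * ∫ y, ({y : EuclideanSpace ℝ (Fin d) | R / 4 ≤ ‖y‖}.indicator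
          (fun y => ‖y‖ ^ 2) y) ∂μ) atTop (𝓝 0) := by
  have : Tendsto (fun R : ℝ => ∫ y, ({y : EuclideanSpace ℝ (Fin d) | R / 4 ≤ ‖y‖}.indicator
          (fun y => ‖y‖ ^ 2) y) ∂μ) atTop (𝓝 (∫ y, (0 : ℝ) ∂μ)) := by
    refine tendsto_integral_filter_of_dominated_convergence (fun y => ‖y‖ ^ 2)
      (Eventually.of_forall fun R => ?_) (Eventually.of_forall fun R => ae_of_all _ fun y => ?_)
      hmom (ae_of_all _ fun y => ?_)
    · exact (hmom.indicator (measurableSet_le measurable_const measurable_norm)).1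
    · refine (norm_indicator_le_norm_self _ _).trans ?_
      simp
    · refine tendsto_const_nhds.congr' ?_
      filter_upwards [eventually_gt_atTop (4 * ‖y‖)] with R hR
      rw [Set.indicator_of_notMem]
      simp only [Set.mem_setOf_eq, not_le]
      linarith
  simpa using this.const_mul 25

section Walk

variable {Ω : Type} [MeasureSpace Ω] [IsProbabilityMeasure (ℙ : Measure Ω)] {d ℓ : ℕ}
    {F : ℕ → MeasurableSpace Ω}
    {X : ℕ → Ω → EuclideanSpace ℝ (Fin d)}
    {I : ℕ → Ω → Fin ℓ}
    {μ : Fin ℓ → Measure (EuclideanSpace ℝ (Fin d))}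

lemma walk_meas (h : IsAdaptiveWalk F X I μ) (t : ℕ) : Measurable (X t) :=
  (h.adaptedX t).mono (h.le t) le_rfl

lemma walk_indep [hprob : ∀ i, IsProbabilityMeasure (μ i)] (h : IsAdaptiveWalk F X I μ) (t : ℕ)
    (i : Fin ℓ) {B : Set Ω}
    (hB : MeasurableSet[F t] B) (hBi : B ⊆ I t ⁻¹' {i})
    {s : Set (EuclideanSpace ℝ (Fin d))} (hs : MeasurableSet s) :
    ℙ (B ∩ (fun ω => X (t + 1) ω - X t ω) ⁻¹' s) = ℙ B * μ i s := by
  have hB' : MeasurableSet B := h.le t _ hB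
  have hY : Measurable (fun ω => X (t + 1) ω - X t ω) :=
    (walk_meas h (t + 1)).sub (walk_meas h t)
  have hpre : MeasurableSet ((fun ω => X (t + 1) ω - X t ω) ⁻¹' s) := hY hs
  have hf : (fun ω => s.indicator (fun _ => (1 : ℝ)) (X (t + 1) ω - X t ω))
      = ((fun ω => X (t + 1) ω - X t ω) ⁻¹' s).indicator (fun _ => (1 : ℝ)) := by
    rfl
  have hint : Integrable (fun ω => s.indicator (fun _ => (1 : ℝ)) (X (t + 1) ω - X t ω))
      (ℙ : Measure Ω) := by
    rw [hf]
    exact (integrable_const _).indicator hpre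
  have h1 := setIntegral_condExp (h.le t) hint hB
  have h2 : ∫ ω in B, (ℙ[fun ω => s.indicator (fun _ => (1 : ℝ)) (X (t + 1) ω - X t ω)|F t]) ω
      = ∫ ω in B, (μ i s).toReal := by
    apply setIntegral_congr_ae hB'
    filter_upwards [h.cond t s hs] with ω hω hωB
    rw [hω]
    have : I t ω = i := hBi hωB
    rw [this]
  rw [h2, hf, setIntegral_indicator hpre] at h1
  simp only [setIntegral_const, smul_eq_mul, mul_one, Measure.real] at h1
  rw [← ENNReal.toReal_mul] at h1
  exact ((ENNReal.toReal_eq_toReal_iff' (ENNReal.mul_ne_top (measure_ne_top _ _)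
    (measure_ne_top _ _)) (measure_ne_top _ _)).1 h1).symm

lemma walk_joint [hprob : ∀ i, IsProbabilityMeasure (μ i)] (h : IsAdaptiveWalk F X I μ) (t : ℕ)
    (i : Fin ℓ) {B : Set Ω}
    (hB : MeasurableSet[F t] B) (hBi : B ⊆ I t ⁻¹' {i}) :
    ((ℙ : Measure Ω).restrict B).map (fun ω => (X t ω, X (t + 1) ω - X t ω))
      = (((ℙ : Measure Ω).restrict B).map (X t)).prod (μ i) := by
  have hX := walk_meas h t
  have hY : Measurable (fun ω => X (t + 1) ω - X t ω) :=
    (walk_meas h (t + 1)).sub (walk_meas h t)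
  symm
  apply Measure.prod_eq
  intro s s' hs hs'
  rw [Measure.map_apply (hX.prodMk hY) (hs.prod hs'), Measure.map_apply hX hs,
    Measure.restrict_apply ((hX.prodMk hY) (hs.prod hs')), Measure.restrict_apply (hX hs)]
  have hC : MeasurableSet[F t] (X t ⁻¹' s ∩ B) :=
    MeasurableSet.inter (h.adaptedX t hs) hB
  rw [← walk_indep h t i hC (Set.inter_subset_right.trans hBi) hs']
  congr 1
  ext ω
  simp only [Set.mem_inter_iff, Set.mem_preimage, Set.mem_prod]
  tauto

/-- The walk has stayed in the ball at times `1, …, t`. -/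
def stay (X : ℕ → Ω → EuclideanSpace ℝ (Fin d)) (x : EuclideanSpace ℝ (Fin d)) (R : ℝ) (t : ℕ) :
    Set Ω := {ω | ∀ s : ℕ, 1 ≤ s → s ≤ t → ‖x + X s ω‖ ≤ R}

lemma stay_meas (h : IsAdaptiveWalk F X I μ) (x : EuclideanSpace ℝ (Fin d)) (R : ℝ) (t : ℕ) :
    MeasurableSet[F t] (stay X x R t) := by
  have : stay X x R t = ⋂ s : ℕ, ⋂ _ : 1 ≤ s, ⋂ _ : s ≤ t,
      X s ⁻¹' {w | ‖x + w‖ ≤ R} := by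
    ext ω; simp [stay]
  rw [this]
  refine MeasurableSet.iInter fun s => MeasurableSet.iInter fun _ => MeasurableSet.iInter
    fun hst => ?_
  apply h.mono hst
  apply h.adaptedX s
  exact measurableSet_le (by fun_prop) measurable_const

lemma walk_step [hprob : ∀ i, IsProbabilityMeasure (μ i)] (h : IsAdaptiveWalk F X I μ)
    (x : EuclideanSpace ℝ (Fin d)) {R q : ℝ} (hq : 0 ≤ q)
    (hstep : ∀ i, ∀ z : EuclideanSpace ℝ (Fin d), ‖z‖ ≤ R →
      ∫⁻ y, ENNReal.ofReal (klyap R (z + y)) ∂(μ i) ≤ ENNReal.ofReal (q * lyap R z))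
    (t : ℕ) (ht : 1 ≤ t) :
    ∫⁻ ω in stay X x R (t + 1), ENNReal.ofReal (lyap R (x + X (t + 1) ω))
      ≤ ENNReal.ofReal q * ∫⁻ ω in stay X x R t, ENNReal.ofReal (lyap R (x + X t ω)) := by
  have hX := walk_meas h t
  have hX1 := walk_meas h (t + 1)
  have hY : Measurable (fun ω => X (t + 1) ω - X t ω) := hX1.sub hX
  have hsm : ∀ t, MeasurableSet (stay X x R t) := fun t => h.le t _ (stay_meas h x R t)
  have hsub : stay X x R (t + 1) ⊆ stay X x R t := fun ω hω s h1 h2 => hω s h1 (by omega)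
  have hkm : Measurable fun ω => ENNReal.ofReal (klyap R (x + X (t + 1) ω)) :=
    ((measurable_klyap R).comp (hX1.const_add x)).ennreal_ofReal
  -- replace by the killed function
  have h1 : ∫⁻ ω in stay X x R (t + 1), ENNReal.ofReal (lyap R (x + X (t + 1) ω))
      ≤ ∫⁻ ω in stay X x R t, ENNReal.ofReal (klyap R (x + X (t + 1) ω)) := by
    refine le_trans (le_of_eq ?_) (lintegral_mono_set hsub)
    apply setLIntegral_congr_fun (hsm _)
    intro ω hω
    have : ‖x + X (t + 1) ω‖ ≤ R := hω (t + 1) (by omega) le_rfl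
    simp only [klyap]
    rw [Set.indicator_of_mem (mem_closedBall_zero_iff.2 this)]
  refine h1.trans ?_
  -- partition by the index
  set A : Fin ℓ → Set Ω := fun i => stay X x R t ∩ I t ⁻¹' {i} with hA
  have hAF : ∀ i, MeasurableSet[F t] (A i) := fun i =>
    MeasurableSet.inter (stay_meas h x R t) (h.adaptedI t (measurableSet_singleton i))
  have hAm : ∀ i, MeasurableSet (A i) := fun i => h.le t _ (hAF i)
  have hAd : Pairwise (Function.onFun Disjoint A) := by
    intro i j hij
    refine Set.disjoint_left.2 fun ω hi hj => hij ?_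
    have e1 : I t ω = i := hi.2
    have e2 : I t ω = j := hj.2
    rw [← e1, e2]
  have hAU : stay X x R t = ⋃ i, A i := by
    ext ω; simp [hA]
  rw [hAU, lintegral_iUnion hAm hAd, lintegral_iUnion hAm hAd, ← ENNReal.tsum_mul_left]
  refine ENNReal.tsum_le_tsum fun i => ?_
  have hG : Measurable fun p : EuclideanSpace ℝ (Fin d) × EuclideanSpace ℝ (Fin d) =>
      ENNReal.ofReal (klyap R (x + p.1 + p.2)) :=
    ((measurable_klyap R).comp (by fun_prop)).ennreal_ofReal
  have h2 : ∫⁻ ω in A i, ENNReal.ofReal (klyap R (x + X (t + 1) ω))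
      = ∫⁻ p, ENNReal.ofReal (klyap R (x + p.1 + p.2))
        ∂(((ℙ : Measure Ω).restrict (A i)).map (fun ω => (X t ω, X (t + 1) ω - X t ω))) := by
    rw [lintegral_map hG (hX.prodMk hY)]
    congr 1
    ext ω
    congr 2
    simp only
    abel
  rw [h2, walk_joint h t i (hAF i) Set.inter_subset_right, lintegral_prod _ hG.aemeasurable,
    lintegral_map hG.lintegral_prod_right' hX, ← lintegral_const_mul' _ _ ENNReal.ofReal_ne_top]
  apply setLIntegral_mono' (hAm i)
  intro ω hω
  have hR : ‖x + X t ω‖ ≤ R := hω.1 t ht le_rfl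
  refine (hstep i _ hR).trans ?_
  rw [ENNReal.ofReal_mul hq]

lemma walk_bound [hprob : ∀ i, IsProbabilityMeasure (μ i)] (h : IsAdaptiveWalk F X I μ)
    (x : EuclideanSpace ℝ (Fin d)) {R q : ℝ} (hR : 0 < R) (hq : 0 ≤ q)
    (hstep : ∀ i, ∀ z : EuclideanSpace ℝ (Fin d), ‖z‖ ≤ R →
      ∫⁻ y, ENNReal.ofReal (klyap R (z + y)) ∂(μ i) ≤ ENNReal.ofReal (q * lyap R z))
    (n : ℕ) :
    ℙ (stay X x R (n + 1)) ≤ ENNReal.ofReal (2 * q ^ n) := by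
  have hM : ∀ n : ℕ, ∫⁻ ω in stay X x R (n + 1), ENNReal.ofReal (lyap R (x + X (n + 1) ω))
      ≤ ENNReal.ofReal (2 * q ^ n) := by
    intro n
    induction n with
    | zero =>
      calc ∫⁻ ω in stay X x R (0 + 1), ENNReal.ofReal (lyap R (x + X (0 + 1) ω))
          ≤ ∫⁻ ω in stay X x R (0 + 1), ENNReal.ofReal 2 :=
            lintegral_mono fun ω => ENNReal.ofReal_le_ofReal (lyap_le_two _ _)
        _ ≤ ENNReal.ofReal 2 * 1 := by
            rw [setLIntegral_const]
            gcongr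
            exact prob_le_one
        _ = _ := by simp
    | succ n ih =>
      refine (walk_step h x hq hstep (n + 1) (by omega)).trans ?_
      calc _ ≤ ENNReal.ofReal q * ENNReal.ofReal (2 * q ^ n) := by gcongr
        _ = _ := by
          rw [← ENNReal.ofReal_mul hq]
          congr 1
          ring
  refine le_trans ?_ (hM n)
  have hsm : MeasurableSet (stay X x R (n + 1)) := h.le _ _ (stay_meas h x R _)
  calc ℙ (stay X x R (n + 1)) = ∫⁻ ω in stay X x R (n + 1), 1 := by simp
    _ ≤ _ := by
      apply setLIntegral_mono' hsm
      intro ω hω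
      rw [← ENNReal.ofReal_one]
      exact ENNReal.ofReal_le_ofReal (one_le_lyap hR (hω _ (by omega) le_rfl))

end Walk

/-- Let `μ 0, …, μ (ℓ−1)` be centered probability measures on `ℝᵈ` with finite
second moments and non-singular covariance matrices. There is `C > 0` such that every adaptive
random walk `X` using these measures satisfies, for all `R > C`, `x ∈ ℝᵈ` and `δ > 0`,
`P(x + X t ∈ B(0,R) for all integers 1 ≤ t ≤ R^{2+δ}) ≤ C·exp(−R^δ/C)`. -/
theorem stmt17 (d ℓ : ℕ) (hd : 1 ≤ d) (hℓ : 1 ≤ ℓ)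
    (μ : Fin ℓ → Measure (EuclideanSpace ℝ (Fin d)))
    (hprob : ∀ i, IsProbabilityMeasure (μ i))
    (hcent : ∀ i, ∫ y, y ∂μ i = 0)
    (hmom : ∀ i, Integrable (fun y => ‖y‖ ^ 2) (μ i))
    (hcov : ∀ i, IsUnit (Matrix.of fun a b : Fin d => ∫ y, y a * y b ∂μ i)) :
    ∃ C : ℝ, 0 < C ∧
      ∀ (Ω : Type) (_ : MeasureSpace Ω),
        IsProbabilityMeasure (ℙ : Measure Ω) →
        ∀ (F : ℕ → MeasurableSpace Ω) (X : ℕ → Ω → EuclideanSpace ℝ (Fin d))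
          (I : ℕ → Ω → Fin ℓ),
          IsAdaptiveWalk F X I μ →
          ∀ R : ℝ, C < R → ∀ x : EuclideanSpace ℝ (Fin d), ∀ δ : ℝ, 0 < δ →
            ℙ {ω : Ω | ∀ t : ℕ, 1 ≤ t → (t : ℝ) ≤ R ^ (2 + δ) → ‖x + X t ω‖ ≤ R}
              ≤ ENNReal.ofReal (C * Real.exp (-(R ^ δ) / C)) := by
  have hmpos : ∀ i, 0 < ∫ y, ‖y‖ ^ 2 ∂μ i := fun i => second_moment_pos hd _ (hmom i) (hcov i)
  haveI : Nonempty (Fin ℓ) := ⟨⟨0, hℓ⟩⟩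
  obtain ⟨i₀, hi₀⟩ := Finite.exists_min (fun i => ∫ y, ‖y‖ ^ 2 ∂μ i)
  obtain ⟨c, hc, hcm⟩ : ∃ c : ℝ, 0 < c ∧ ∀ i, 4 * c ≤ ∫ y, ‖y‖ ^ 2 ∂μ i := by
    refine ⟨(∫ y, ‖y‖ ^ 2 ∂μ i₀) / 4, by linarith [hmpos i₀], fun i => ?_⟩
    linarith [hi₀ i]
  have hev : ∀ᶠ R : ℝ in atTop, ∀ i,
      25 * ∫ y, ({y : EuclideanSpace ℝ (Fin d) | R / 4 ≤ ‖y‖}.indicator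
          (fun y => ‖y‖ ^ 2) y) ∂μ i ≤ 2 * c := by
    rw [eventually_all]
    intro i
    exact ((tail_tendsto (μ i) (hmom i)).eventually_lt_const (by linarith : 0 < 2 * c)).mono
      fun _ h => h.le
  obtain ⟨R₀, hR₀⟩ := eventually_atTop.1 hev
  refine ⟨max (max R₀ (1 + c)) (max (1 / c) (2 * Real.exp (2 * c))), ?_, ?_⟩
  · exact lt_of_lt_of_le (by linarith) ((le_max_right _ _).trans (le_max_left _ _))
  set C := max (max R₀ (1 + c)) (max (1 / c) (2 * Real.exp (2 * c))) with hC
  have hC1 : R₀ ≤ C := (le_max_left _ _).trans (le_max_left _ _)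
  have hC2 : 1 + c ≤ C := (le_max_right _ _).trans (le_max_left _ _)
  have hC3 : 1 / c ≤ C := (le_max_left _ _).trans (le_max_right _ _)
  have hC4 : 2 * Real.exp (2 * c) ≤ C := (le_max_right _ _).trans (le_max_right _ _)
  have hCpos : 0 < C := by linarith
  intro Ω _ _ F X I h R hR x δ hδ
  have hR1 : 1 < R := by linarith
  have hR0 : 0 < R := by linarith
  have hRc : c ≤ R ^ 2 := by nlinarith
  have hR2 : 0 < R ^ 2 := by positivity
  have hq : 0 ≤ 1 - c / R ^ 2 := by
    have : c / R ^ 2 ≤ 1 := (div_le_one hR2).2 hRc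
    linarith
  have hN1 : 1 ≤ R ^ (2 + δ) := Real.one_le_rpow hR1.le (by linarith)
  have hfl : 1 ≤ ⌊R ^ (2 + δ)⌋₊ := Nat.one_le_floor_iff _ |>.2 hN1
  obtain ⟨n, hn⟩ : ∃ n, ⌊R ^ (2 + δ)⌋₊ = n + 1 := ⟨_, (Nat.sub_add_cancel hfl).symm⟩
  have hb := walk_bound h x hR0 hq (fun i z hz =>
    one_step (μ i) (hcent i) (hmom i) hc hR0 (hcm i) (hR₀ R (by linarith) i) z hz) n
  refine le_trans (measure_mono ?_) (hb.trans (ENNReal.ofReal_le_ofReal ?_))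
  · intro ω hω s hs1 hs2
    refine hω s hs1 ?_
    rw [← hn] at hs2
    exact (Nat.le_floor_iff (by positivity)).1 hs2
  · have hnlt : R ^ (2 + δ) < n + 2 := by
      have := Nat.lt_floor_add_one (R ^ (2 + δ))
      rw [hn] at this
      push_cast at this
      linarith
    have hsplit : R ^ (2 + δ) = R ^ 2 * R ^ δ := by
      rw [Real.rpow_add hR0]
      norm_cast
    have e1 : (1 - c / R ^ 2) ^ n ≤ Real.exp (-(c / R ^ 2) * n) := by
      calc (1 - c / R ^ 2) ^ n ≤ (Real.exp (-(c / R ^ 2))) ^ n := by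
            gcongr
            linarith [Real.add_one_le_exp (-(c / R ^ 2))]
        _ = _ := by rw [← Real.exp_nat_mul]; ring_nf
    have hcR : c / R ^ 2 ≤ c := div_le_self hc.le (by nlinarith)
    have e2 : -(c / R ^ 2) * n ≤ 2 * c + -(R ^ δ) / C := by
      have f1 : c / R ^ 2 * (R ^ 2 * R ^ δ) ≤ c / R ^ 2 * (n + 2) := by
        rw [← hsplit]
        have : 0 ≤ c / R ^ 2 := by positivity
        gcongr
      have f2 : c / R ^ 2 * (R ^ 2 * R ^ δ) = c * R ^ δ := by field_simp
      have f3 : R ^ δ / C ≤ c * R ^ δ := by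
        rw [div_le_iff₀ hCpos]
        have : 1 ≤ c * C := by
          rw [div_le_iff₀ hc] at hC3
          linarith
        have hp : 0 < R ^ δ := by positivity
        nlinarith
      rw [neg_div]
      nlinarith
    calc 2 * (1 - c / R ^ 2) ^ n ≤ 2 * Real.exp (2 * c + -(R ^ δ) / C) := by
          gcongr
          exact e1.trans (Real.exp_le_exp.2 e2)
      _ = 2 * Real.exp (2 * c) * Real.exp (-(R ^ δ) / C) := by rw [Real.exp_add]; ring
      _ ≤ _ := by gcongr
end

section
/- Let k, d, ℓ be positive integers with k ≥ 2, d > k and ℓ·(k−1) ≤ d−1. Let μ₁, …, μ_ℓ be centered probability measures on ℝᵈ with finite second moments and non-singular covariance matrices. Then there exists ε > 0 such that for every R > 0 there is a constant C_R > 0 with the following property: every adaptive random walk (X_t)_{t ≥ 0} using μ₁, …, μ_ℓ satisfies, for every T > 0, P( there exists t > T with X_t ∈ B(0,R) ) ≤ C_R · T^{−(k−2)/2 − ε}. -/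
open MeasureTheory Matrix
open scoped ProbabilityTheory

section LinAlg
open scoped Matrix.Norms.L2Operator

lemma aw_trace_of_card {d k : ℕ} (hkd : k < d) (lam : Fin d → ℝ) (L : ℝ) (hL : 0 < L)
    (hpos : ∀ a, 0 < lam a)
    (hcard : k ≤ (Finset.univ.filter (fun a => lam a = L)).card) :
    (k : ℝ) * L < ∑ a, lam a := by
  classical
  rw [← Finset.sum_filter_add_sum_filter_not Finset.univ (fun a => lam a = L)]
  have h1 : ∑ a ∈ Finset.univ.filter (fun a => lam a = L), lam a
      = ((Finset.univ.filter (fun a => lam a = L)).card : ℝ) * L := by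
    rw [Finset.sum_congr rfl (g := fun _ => L)]
    · simp
    · intro a ha; exact (Finset.mem_filter.1 ha).2
  rw [h1]
  have hc : (k : ℝ) ≤ ((Finset.univ.filter (fun a => lam a = L)).card : ℝ) := by exact_mod_cast hcard
  have h2 : 0 ≤ ∑ a ∈ Finset.univ.filter (fun a => ¬ lam a = L), lam a :=
    Finset.sum_nonneg (fun a _ => (hpos a).le)
  rcases hcard.lt_or_eq with h | h
  · have hc' : (k : ℝ) < ((Finset.univ.filter (fun a => lam a = L)).card : ℝ) := by exact_mod_cast h
    nlinarith
  · have : 0 < ∑ a ∈ Finset.univ.filter (fun a => ¬ lam a = L), lam a := by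
      apply Finset.sum_pos (fun a _ => hpos a)
      by_contra hne
      rw [Finset.not_nonempty_iff_eq_empty] at hne
      have := Finset.card_filter_add_card_filter_not (s := (Finset.univ : Finset (Fin d))) (fun a => lam a = L)
      rw [hne, ← h] at this
      simp at this
      omega
    nlinarith

lemma aw_exists_t {d : ℕ} (lam : Fin d → ℝ) (L : ℝ)
    (hle : ∀ a, lam a ≤ L) :
    ∃ t : ℝ, 0 < t ∧ t < 1 ∧ ∀ a, lam a ≠ L → lam a ≤ t ^ 2 * L := by
  classical
  have h : ∀ a, ∀ᶠ t : ℝ in nhdsWithin 1 (Set.Iio 1), lam a ≠ L → lam a ≤ t ^ 2 * L := by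
    intro a
    by_cases ha : lam a = L
    · filter_upwards with t ht; exact absurd ha ht
    · have hlt : lam a < (1:ℝ) ^ 2 * L := by simpa using lt_of_le_of_ne (hle a) ha
      have hc : Filter.Tendsto (fun t : ℝ => t ^ 2 * L) (nhdsWithin 1 (Set.Iio 1)) (nhds (1 ^ 2 * L)) :=
        (Continuous.tendsto (by fun_prop) 1).mono_left nhdsWithin_le_nhds
      filter_upwards [hc.eventually (lt_mem_nhds hlt)] with t ht _ using ht.le
  have h2 : ∀ᶠ t : ℝ in nhdsWithin 1 (Set.Iio 1), 0 < t :=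
    nhdsWithin_le_nhds (lt_mem_nhds one_pos)
  have h3 : ∀ᶠ t : ℝ in nhdsWithin 1 (Set.Iio 1), t < 1 := self_mem_nhdsWithin
  obtain ⟨t, ht⟩ := ((Filter.eventually_all.2 h).and (h2.and h3)).exists
  exact ⟨t, ht.2.1, ht.2.2, ht.1⟩

lemma aw_max_exists {d ℓ : ℕ} (hd : 0 < d) (hl : 0 < ℓ) (A : Fin ℓ → Matrix (Fin d) (Fin d) ℝ)
    (hA : ∀ i, (A i).PosDef) :
    ∃ S : Matrix (Fin d) (Fin d) ℝ, S.det ≠ 0 ∧ ∀ W : Matrix (Fin d) (Fin d) ℝ, W.det ≠ 0 →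
      (W * S).det ^ (2 * ℓ) * ∏ i, ‖S * A i * Sᵀ‖ ^ d
        ≤ S.det ^ (2 * ℓ) * ∏ i, ‖(W * S) * A i * (W * S)ᵀ‖ ^ d := by
  have : Nonempty (Fin d) := ⟨⟨0, hd⟩⟩
  have : Nontrivial (Matrix (Fin d) (Fin d) ℝ) := inferInstance
  have hne : ∀ S : Matrix (Fin d) (Fin d) ℝ, S ≠ 0 → ∀ i, ‖S * A i * Sᵀ‖ ≠ 0 := by
    intro S hS i h
    rw [norm_eq_zero] at h
    apply hS
    have hx : ∀ x, Sᵀ *ᵥ x = 0 := by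
      intro x
      by_contra hx
      have h1 := (hA i).dotProduct_mulVec_pos hx
      have h2 : x ⬝ᵥ ((S * A i * Sᵀ) *ᵥ x) = 0 := by rw [h]; simp
      have h3 : x ⬝ᵥ ((S * A i * Sᵀ) *ᵥ x) = star (Sᵀ *ᵥ x) ⬝ᵥ (A i *ᵥ (Sᵀ *ᵥ x)) := by
        rw [← Matrix.mulVec_mulVec, ← Matrix.mulVec_mulVec, Matrix.dotProduct_mulVec]
        simp [Matrix.mulVec_transpose]
      linarith
    have : Sᵀ = 0 := by
      ext a b
      have := congrFun (hx (Pi.single b 1)) a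
      simpa using this
    simpa using congrArg Matrix.transpose this
  have hcont : ContinuousOn (fun S : Matrix (Fin d) (Fin d) ℝ =>
      S.det ^ (2 * ℓ) / ∏ i, ‖S * A i * Sᵀ‖ ^ d) (Metric.sphere 0 1) := by
    apply ContinuousOn.div
    · apply Continuous.continuousOn
      apply Continuous.pow
      exact Continuous.matrix_det continuous_id
    · apply Continuous.continuousOn
      refine continuous_finsetProd _ (fun i _ => ?_)
      apply Continuous.pow
      apply Continuous.norm
      exact (continuous_id.matrix_mul continuous_const).matrix_mul continuous_id.matrix_transpose
    · intro S hS
      apply Finset.prod_ne_zero_iff.2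
      intro i _
      apply pow_ne_zero
      apply hne
      rintro rfl
      simp at hS
  obtain ⟨S, hS, hmax⟩ := (isCompact_sphere (0 : Matrix (Fin d) (Fin d) ℝ) 1).exists_isMaxOn
    (NormedSpace.sphere_nonempty.2 zero_le_one) hcont
  have hScale : ∀ W : Matrix (Fin d) (Fin d) ℝ, W ≠ 0 →
      W.det ^ (2 * ℓ) / ∏ i, ‖W * A i * Wᵀ‖ ^ d ≤ S.det ^ (2 * ℓ) / ∏ i, ‖S * A i * Sᵀ‖ ^ d := by
    intro W hW
    have hWn : ‖W‖ ≠ 0 := norm_ne_zero_iff.2 hW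
    have := hmax (show (‖W‖⁻¹ • W) ∈ Metric.sphere 0 1 by
      simp [norm_smul, hWn])
    simp only [Set.mem_ofPred_eq] at this
    refine le_trans (le_of_eq ?_) this
    have e1 : ∀ i, ‖(‖W‖⁻¹ • W) * A i * (‖W‖⁻¹ • W)ᵀ‖ ^ d = (‖W‖⁻¹) ^ (2 * d) * ‖W * A i * Wᵀ‖ ^ d := by
      intro i
      rw [Matrix.transpose_smul, Matrix.smul_mul, Matrix.smul_mul, Matrix.mul_smul, norm_smul, norm_smul,
        norm_inv, norm_norm, pow_mul]
      ring
    simp_rw [e1]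
    rw [Finset.prod_mul_distrib, Matrix.det_smul]
    simp only [Fintype.card_fin, Finset.prod_const, Finset.card_univ]
    rw [mul_pow, ← pow_mul, ← pow_mul]
    have e2 : d * (2 * ℓ) = 2 * d * ℓ := by ring
    rw [e2, mul_div_mul_left]
    exact pow_ne_zero _ (inv_ne_zero hWn)
  have hSdet : S.det ≠ 0 := by
    intro h0
    · have := hScale 1 one_ne_zero
      rw [h0, zero_pow (by omega), zero_div] at this
      have h2 : 0 < (1 : Matrix (Fin d) (Fin d) ℝ).det ^ (2 * ℓ) / ∏ i, ‖1 * A i * (1 : Matrix (Fin d) (Fin d) ℝ)ᵀ‖ ^ d := by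
        apply div_pos
        · simp
        · apply Finset.prod_pos
          intro i _
          exact pow_pos (lt_of_le_of_ne (norm_nonneg _) (hne 1 one_ne_zero i).symm) _
      linarith
  refine ⟨S, hSdet, ?_⟩
  intro W hW
  have hWS : (W * S).det ≠ 0 := by rw [Matrix.det_mul]; exact mul_ne_zero hW hSdet
  have hWS0 : W * S ≠ 0 := by
    intro h; rw [h, Matrix.det_zero] at hWS; exact hWS rfl
  have hS0 : S ≠ 0 := by
    intro h; rw [h, Matrix.det_zero] at hSdet; exact hSdet rfl
  have := hScale _ hWS0
  rw [div_le_div_iff₀] at this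
  · exact this
  · exact Finset.prod_pos fun i _ => pow_pos (lt_of_le_of_ne (norm_nonneg _) (hne _ hWS0 i).symm) _
  · exact Finset.prod_pos fun i _ => pow_pos (lt_of_le_of_ne (norm_nonneg _) (hne _ hS0 i).symm) _

set_option maxHeartbeats 1000000 in
lemma aw_precond {d ℓ k : ℕ} (hk : 1 ≤ k) (hl0 : 0 < ℓ) (hkd : k < d) (hl : ℓ * (k - 1) ≤ d - 1)
    (A : Fin ℓ → Matrix (Fin d) (Fin d) ℝ)
    (hA : ∀ i, (A i).PosDef) :
    ∃ S : Matrix (Fin d) (Fin d) ℝ, ∃ L : Fin ℓ → ℝ, ∀ i, 0 < L i ∧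
      (∀ x : Fin d → ℝ, x ⬝ᵥ ((S * A i * Sᵀ) *ᵥ x) ≤ L i * (x ⬝ᵥ x)) ∧
      (k : ℝ) * L i < (S * A i * Sᵀ).trace := by
  classical
  obtain ⟨S, hS, hmax⟩ := aw_max_exists (by omega) hl0 A hA
  refine ⟨S, fun i => ‖S * A i * Sᵀ‖, fun j => ?_⟩
  have hPD : ∀ i, (S * A i * Sᵀ).PosDef := by
    intro i
    have := (hA i).mul_mul_conjTranspose_same (B := S) (by
      exact Matrix.vecMul_injective_of_isUnit ((Matrix.isUnit_iff_isUnit_det S).2 (isUnit_iff_ne_zero.2 hS)))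
    simpa using this
  have : Nonempty (Fin d) := ⟨⟨0, by omega⟩⟩
  have hnpos : ∀ i, 0 < ‖S * A i * Sᵀ‖ := by
    intro i
    rw [norm_pos_iff]
    intro h
    have h1 := (hPD i).det_pos
    rw [h, Matrix.det_zero] at h1
    exact lt_irrefl _ h1
  refine ⟨hnpos j, ?_, ?_⟩
  · intro x
    have h1 := Matrix.l2_opNorm_mulVec (S * A j * Sᵀ) (WithLp.toLp 2 x)
    have h2 := real_inner_le_norm (WithLp.toLp 2 x) ((EuclideanSpace.equiv (Fin d) ℝ).symm ((S * A j * Sᵀ) *ᵥ x))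
    have h3 : inner ℝ (WithLp.toLp 2 x) ((EuclideanSpace.equiv (Fin d) ℝ).symm ((S * A j * Sᵀ) *ᵥ x))
      = x ⬝ᵥ ((S * A j * Sᵀ) *ᵥ x) := by
      simp [PiLp.inner_apply, dotProduct, mul_comm]
    have h4 : x ⬝ᵥ x = ‖WithLp.toLp 2 x‖ ^ 2 := by
      rw [EuclideanSpace.norm_sq_eq]; simp [dotProduct, sq]
    rw [← h3, h4]
    calc _ ≤ _ := h2
      _ ≤ ‖WithLp.toLp 2 x‖ * (‖S * A j * Sᵀ‖ * ‖WithLp.toLp 2 x‖) := by gcongr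
      _ = _ := by ring
  · set B := S * A j * Sᵀ with hB
    have hH : B.IsHermitian := (hPD j).isHermitian
    set lam := hH.eigenvalues with hlam
    set U := hH.eigenvectorUnitary with hU
    have hspec : B = (U : Matrix (Fin d) (Fin d) ℝ) * diagonal lam * star (U : Matrix (Fin d) (Fin d) ℝ) := by
      have := hH.spectral_theorem
      rw [Unitary.conjStarAlgAut_apply] at this
      exact this
    have hposl : ∀ a, 0 < lam a := fun a => (hPD j).eigenvalues_pos a
    have hconj : ∀ v : Fin d → ℝ,
        ‖(U : Matrix (Fin d) (Fin d) ℝ) * diagonal v * star (U : Matrix (Fin d) (Fin d) ℝ)‖ = ‖v‖ := by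
      intro v
      have := CStarRing.norm_mul_coe_unitary ((U : Matrix (Fin d) (Fin d) ℝ) * diagonal v) (star U)
      rw [Unitary.coe_star] at this
      rw [this, CStarRing.norm_coe_unitary_mul, Matrix.l2_opNorm_diagonal]
    have hBn : ‖B‖ = ‖lam‖ := by
      conv_lhs => rw [hspec]
      exact hconj lam
    have hle : ∀ a, lam a ≤ ‖B‖ := by
      intro a
      rw [hBn]
      exact (le_abs_self _).trans (norm_le_pi_norm lam a)
    have htr : B.trace = ∑ a, lam a := by
      have := hH.trace_eq_sum_eigenvalues
      simpa using this
    rw [htr]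
    apply aw_trace_of_card hkd lam ‖B‖ (hnpos j) hposl
    obtain ⟨t, ht0, ht1, ht⟩ := aw_exists_t lam ‖B‖ hle
    set e : Fin d → ℝ := fun a => if lam a = ‖B‖ then t else 1 with he
    set W := (U : Matrix (Fin d) (Fin d) ℝ) * diagonal e * star (U : Matrix (Fin d) (Fin d) ℝ) with hW
    have hUU : star (U : Matrix (Fin d) (Fin d) ℝ) * (U : Matrix (Fin d) (Fin d) ℝ) = 1 := Unitary.coe_star_mul_self U
    set r := (Finset.univ.filter (fun a => lam a = ‖B‖)).card with hr
    have hdetW : W.det = t ^ r := by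
      have h1 : (star (U : Matrix (Fin d) (Fin d) ℝ)).det * (U : Matrix (Fin d) (Fin d) ℝ).det = 1 := by
        rw [← Matrix.det_mul, hUU, Matrix.det_one]
      rw [hW, Matrix.det_mul, Matrix.det_mul, mul_comm, ← mul_assoc, h1, one_mul, Matrix.det_diagonal]
      simp only [he]
      rw [Finset.prod_ite]
      simp [hr]
    have hWt : Wᵀ = W := by
      have : star W = W := by
        rw [hW]
        simp only [star_mul, star_star]
        rw [Matrix.star_eq_conjTranspose (diagonal e), Matrix.diagonal_conjTranspose]
        simp [mul_assoc]
      simpa [Matrix.star_eq_conjTranspose] using this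
    have hWn : ‖W‖ ≤ 1 := by
      rw [hW, hconj, pi_norm_le_iff_of_nonneg zero_le_one]
      intro a
      simp only [he]
      split_ifs
      · rw [Real.norm_of_nonneg ht0.le]; exact ht1.le
      · simp
    have hexp : ∀ i, (W * S) * A i * (W * S)ᵀ = W * (S * A i * Sᵀ) * W := by
      intro i
      rw [Matrix.transpose_mul, hWt]
      simp only [Matrix.mul_assoc]
    have hi : ∀ i, ‖(W * S) * A i * (W * S)ᵀ‖ ≤ ‖S * A i * Sᵀ‖ := by
      intro i
      rw [hexp]
      calc ‖W * (S * A i * Sᵀ) * W‖ ≤ ‖W‖ * ‖S * A i * Sᵀ‖ * ‖W‖ :=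
            (norm_mul_le _ _).trans (by gcongr; exact norm_mul_le _ _)
        _ ≤ 1 * ‖S * A i * Sᵀ‖ * 1 := by gcongr
        _ = _ := by ring
    have hj : ‖(W * S) * A j * (W * S)ᵀ‖ ≤ t ^ 2 * ‖S * A j * Sᵀ‖ := by
      rw [hexp, ← hB]
      have : W * B * W = (U : Matrix (Fin d) (Fin d) ℝ) * diagonal (fun a => e a * lam a * e a)
          * star (U : Matrix (Fin d) (Fin d) ℝ) := by
        rw [← Matrix.diagonal_mul_diagonal, ← Matrix.diagonal_mul_diagonal]
        conv_lhs => rw [hspec, hW]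
        calc _ = (U : Matrix (Fin d) (Fin d) ℝ) * diagonal e * (star (U : Matrix (Fin d) (Fin d) ℝ) * (U : Matrix (Fin d) (Fin d) ℝ))
                * diagonal lam * (star (U : Matrix (Fin d) (Fin d) ℝ) * (U : Matrix (Fin d) (Fin d) ℝ)) * diagonal e * star (U : Matrix (Fin d) (Fin d) ℝ) := by
              simp only [Matrix.mul_assoc]
          _ = _ := by rw [hUU]; simp only [Matrix.mul_assoc, Matrix.mul_one, Matrix.one_mul]
      rw [this, hconj, pi_norm_le_iff_of_nonneg (by positivity)]
      intro a
      simp only [he]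
      split_ifs with h
      · rw [Real.norm_of_nonneg (by have := hposl a; positivity), h]
        exact le_of_eq (by ring)
      · rw [Real.norm_of_nonneg (by have := hposl a; positivity)]
        simpa using ht a h
    have hm := hmax W (by rw [hdetW]; positivity)
    have hprod : ∏ i, ‖(W * S) * A i * (W * S)ᵀ‖ ^ d ≤ t ^ (2 * d) * ∏ i, ‖S * A i * Sᵀ‖ ^ d := by
      rw [← Finset.mul_prod_erase _ _ (Finset.mem_univ j), ← Finset.mul_prod_erase _ (fun i => ‖S * A i * Sᵀ‖ ^ d) (Finset.mem_univ j),
        ← mul_assoc]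
      apply mul_le_mul
      · rw [pow_mul, ← mul_pow]
        exact pow_le_pow_left₀ (norm_nonneg _) hj d
      · exact Finset.prod_le_prod (fun i _ => by positivity) (fun i _ => pow_le_pow_left₀ (norm_nonneg _) (hi i) d)
      · exact Finset.prod_nonneg (fun i _ => by positivity)
      · positivity
    have hP : 0 < ∏ i, ‖S * A i * Sᵀ‖ ^ d := Finset.prod_pos fun i _ => pow_pos (hnpos i) _
    have hD : 0 < S.det ^ (2 * ℓ) := by rw [pow_mul]; positivity
    have hfin : t ^ (r * (2 * ℓ)) ≤ t ^ (2 * d) := by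
      rw [Matrix.det_mul, hdetW, mul_pow, ← pow_mul] at hm
      have h5 := hm.trans (mul_le_mul_of_nonneg_left hprod hD.le)
      have h6 : t ^ (r * (2 * ℓ)) * (S.det ^ (2 * ℓ) * ∏ i, ‖S * A i * Sᵀ‖ ^ d) ≤
          t ^ (2 * d) * (S.det ^ (2 * ℓ) * ∏ i, ‖S * A i * Sᵀ‖ ^ d) := by linarith
      exact le_of_mul_le_mul_right h6 (mul_pos hD hP)
    have hle2 : 2 * d ≤ r * (2 * ℓ) := (pow_le_pow_iff_right_of_lt_one₀ ht0 ht1).1 hfin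
    by_contra hcon
    push Not at hcon
    have : r * ℓ ≤ (k - 1) * ℓ := Nat.mul_le_mul_right _ (by omega)
    nlinarith [Nat.sub_add_cancel (show 1 ≤ d by omega)]

end LinAlg


section Analytic

lemma aw_poly_rem (m : ℕ) : ∃ K : ℝ, 0 ≤ K ∧ ∀ h : ℝ, |h| ≤ 1 →
    1 - K * |h| ^ 3 ≤ (1 + h) ^ m * (1 - m * h + m * (m + 1) / 2 * h ^ 2) := by
  suffices ∃ K : ℝ, 0 ≤ K ∧ ∀ h : ℝ, |h| ≤ 1 → ∃ r : ℝ, |r| ≤ K ∧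
      (1 + h) ^ m * (1 - m * h + m * (m + 1) / 2 * h ^ 2) = 1 + h ^ 3 * r by
    obtain ⟨K, hK, H⟩ := this
    refine ⟨K, hK, fun h hh => ?_⟩
    obtain ⟨r, hr, e⟩ := H h hh
    rw [e]
    have : |h ^ 3 * r| ≤ |h| ^ 3 * K := by rw [abs_mul, abs_pow]; gcongr
    have := neg_abs_le (h ^ 3 * r)
    linarith
  induction m with
  | zero => exact ⟨0, le_rfl, fun h _ => ⟨0, by simp, by simp⟩⟩
  | succ m ih =>
    obtain ⟨K, hK, H⟩ := ih
    refine ⟨K + 2 ^ m * ((m + 1) * (m + 2) / 2), by positivity, fun h hh => ?_⟩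
    obtain ⟨r, hr, e⟩ := H h hh
    refine ⟨r + (1 + h) ^ m * ((m + 1) * (m + 2) / 2), ?_, ?_⟩
    · have h2 : |(1 + h) ^ m * (((m:ℝ) + 1) * (m + 2) / 2)| ≤ 2 ^ m * ((m + 1) * (m + 2) / 2) := by
        rw [abs_mul, abs_pow, abs_of_nonneg (show (0:ℝ) ≤ (m + 1) * (m + 2) / 2 by positivity)]
        gcongr
        calc |1 + h| ≤ |1| + |h| := abs_add_le _ _
          _ ≤ 2 := by rw [abs_one]; linarith
      exact (abs_add_le _ _).trans (add_le_add hr h2)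
    · have : (1 + h) ^ (m + 1) * (1 - ((m + 1 : ℕ) : ℝ) * h + ((m + 1 : ℕ) : ℝ) * (((m + 1 : ℕ) : ℝ) + 1) / 2 * h ^ 2)
        = (1 + h) ^ m * (1 - m * h + m * (m + 1) / 2 * h ^ 2) + (1 + h) ^ m * ((m + 1) * (m + 2) / 2) * h ^ 3 := by
        push_cast; ring
      rw [this, e]; ring

lemma aw_inv_pow (m : ℕ) : ∃ K : ℝ, 0 ≤ K ∧ ∀ h : ℝ, |h| ≤ 1 / 2 →
    1 / (1 + h) ^ m ≤ 1 - m * h + m * (m + 1) / 2 * h ^ 2 + K * |h| ^ 3 := by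
  obtain ⟨K, hK, H⟩ := aw_poly_rem m
  refine ⟨2 ^ m * K, by positivity, fun h hh => ?_⟩
  have h1 := H h (by linarith)
  have hp : (1:ℝ) / 2 ≤ 1 + h := by have := neg_abs_le h; linarith
  have hpm : 0 < (1 + h) ^ m := pow_pos (by linarith) m
  have hpm2 : (1 / 2 : ℝ) ^ m ≤ (1 + h) ^ m := pow_le_pow_left₀ (by norm_num) hp m
  have h3 : 1 ≤ (1 + h) ^ m * 2 ^ m := by
    rw [← mul_pow]; exact one_le_pow₀ (by linarith)
  rw [div_le_iff₀ hpm]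
  have h4 : K * |h| ^ 3 ≤ ((1 + h) ^ m * 2 ^ m) * (K * |h| ^ 3) :=
    le_mul_of_one_le_left (by positivity) h3
  linarith

lemma aw_small_jump (m : ℕ) (hm : 1 ≤ m) (θ : ℝ) (hθ : 0 < θ) : ∃ δ : ℝ, 0 < δ ∧ δ ≤ 1 ∧
    ∀ β v : ℝ, 0 ≤ v → β ^ 2 ≤ 2 * m * v → v ≤ δ ^ 2 →
      0 < 1 + (β + v / 2) / m ∧
      1 / (1 + (β + v / 2) / m) ^ m ≤ 1 - β - (1 - 2 * θ) * v / 2 + (m + 1) / (2 * m) * β ^ 2 := by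
  obtain ⟨K, hK, H⟩ := aw_inv_pow m
  have hm' : (1:ℝ) ≤ m := by exact_mod_cast hm
  set e : ℝ := min (1 / 2) (θ / (1 + 5 * m * K)) with he
  have hden : 0 < 1 + 5 * m * K := by positivity
  have he0 : 0 < e := lt_min (by norm_num) (by positivity)
  have he1 : e ≤ 1 / 2 := min_le_left _ _
  have he2 : e * (1 + 5 * m * K) ≤ θ := by
    have : e ≤ θ / (1 + 5 * m * K) := min_le_right _ _
    rwa [le_div_iff₀ hden] at this
  refine ⟨e / (2 * m + 1), by positivity, ?_, ?_⟩
  · rw [div_le_one (by positivity)]; linarith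
  intro β v hv hβ hvδ
  set δ := e / (2 * m + 1) with hδ
  have hδ0 : 0 < δ := by positivity
  have hδe : (2 * m + 1) * δ = e := by rw [hδ]; field_simp
  have hδ1 : δ ≤ 1 := by nlinarith
  have hb : |β| ≤ 2 * m * δ := by
    apply abs_le_of_sq_le_sq _ (by positivity)
    nlinarith [mul_le_mul_of_nonneg_left hvδ (show (0:ℝ) ≤ 2 * m by positivity), sq_nonneg δ]
  have hvd : v ≤ δ := by nlinarith
  have hbv : |β| + v ≤ e := by nlinarith
  set h := (β + v / 2) / m with hh
  have hmh : m * h = β + v / 2 := by rw [hh]; field_simp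
  have habs : |β + v / 2| ≤ |β| + v / 2 := by
    calc |β + v / 2| ≤ |β| + |v / 2| := abs_add_le _ _
      _ = _ := by rw [abs_of_nonneg (show 0 ≤ v / 2 by positivity)]
  have hhabs : |h| ≤ |β + v / 2| := by
    rw [hh, abs_div, abs_of_nonneg (show (0:ℝ) ≤ m by positivity)]
    exact div_le_self (abs_nonneg _) hm'
  have hhe : |h| ≤ e := by linarith
  have hh2 : h ^ 2 ≤ 5 * m * v := by
    have : h ^ 2 ≤ (β + v / 2) ^ 2 := sq_le_sq.2 hhabs
    have hv1 : v ≤ 1 := by linarith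
    nlinarith [sq_nonneg (β - v / 2), mul_le_mul_of_nonneg_right hm' hv]
  refine ⟨by have := neg_abs_le h; linarith, (H h (by linarith)).trans ?_⟩
  have h3 : K * |h| ^ 3 ≤ K * (e * (5 * m * v)) := by
    apply mul_le_mul_of_nonneg_left _ hK
    have : |h| ^ 3 = |h| * h ^ 2 := by rw [← sq_abs h]; ring
    rw [this]
    exact mul_le_mul hhe hh2 (sq_nonneg _) he0.le
  have h4 : (m:ℝ) * (m + 1) / 2 * h ^ 2 = (m + 1) / (2 * m) * (m * h) ^ 2 := by field_simp
  have h5 : (m + 1) / (2 * m) * (m * h) ^ 2 ≤ (m + 1) / (2 * m) * β ^ 2 + e * v := by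
    rw [hmh]
    have hc : ((m:ℝ) + 1) / (2 * m) ≤ 1 := by rw [div_le_one (by positivity)]; linarith
    have hc0 : 0 ≤ ((m:ℝ) + 1) / (2 * m) := by positivity
    have h6 : (β + v / 2) ^ 2 ≤ β ^ 2 + e * v := by
      have : β * v ≤ |β| * v := mul_le_mul_of_nonneg_right (le_abs_self _) hv
      nlinarith
    calc _ ≤ (m + 1) / (2 * m) * (β ^ 2 + e * v) := mul_le_mul_of_nonneg_left h6 hc0
      _ ≤ _ := by
        rw [mul_add]
        exact add_le_add le_rfl (mul_le_of_le_one_left (mul_nonneg he0.le hv) hc)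
  rw [hmh, h4]
  have h7 : e * v * (1 + 5 * m * K) ≤ θ * v := by nlinarith
  nlinarith

lemma aw_small_jump' (m : ℕ) (hm : 1 ≤ m) (θ : ℝ) (hθ : 0 < θ) : ∃ δ : ℝ, 0 < δ ∧ δ ≤ 1 ∧
    ∀ Q b n : ℝ, 0 < Q → b ^ 2 ≤ 2 * m * Q * n ^ 2 → n ^ 2 ≤ δ ^ 2 * Q →
      1 / (Q + (b + n ^ 2 / 2) / m) ^ m ≤ 1 / Q ^ m *
        (1 - b / Q - (1 - 2 * θ) / (2 * Q) * n ^ 2 + (m + 1) / (2 * m) / Q ^ 2 * b ^ 2) := by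
  obtain ⟨δ, h0, h1, H⟩ := aw_small_jump m hm θ hθ
  refine ⟨δ, h0, h1, fun Q b n hQ hb hn => ?_⟩
  obtain ⟨h2, h3⟩ := H (b / Q) (n ^ 2 / Q) (by positivity)
    (by rw [div_pow, div_le_iff₀ (by positivity)]; field_simp; linarith)
    (by rw [div_le_iff₀ hQ]; exact hn)
  have hm' : (0:ℝ) < m := by exact_mod_cast hm
  have e1 : Q + (b + n ^ 2 / 2) / m = Q * (1 + (b / Q + n ^ 2 / Q / 2) / m) := by
    field_simp
  rw [e1, mul_pow, ← one_div_mul_one_div]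
  refine (mul_le_mul_of_nonneg_left h3 (by positivity)).trans (le_of_eq ?_)
  field_simp

set_option maxHeartbeats 1000000 in
/-- The final scalar inequality. -/
lemma aw_scalar (m : ℕ) (κ θ η N Nb s Q r Err : ℝ) (hm : 1 ≤ m) (hκ : 0 ≤ κ) (hθ : 0 < θ) (hη : 0 < η)
    (hN : 1 ≤ N) (hNb : N ≤ Nb) (hr : r = m - κ / 2) (hr1 : 1 ≤ r)
    (hmη : (1 + κ / 2) ^ 2 / (4 * (m + 1)) * Nb ≤ η / 16) (hθη : θ * κ * Nb ≤ η / 16)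
    (hs1 : 2 * m * Nb ≤ s) (hs2 : r * m * Nb ^ 2 ≤ η / 8 * s) (hsQ : s ≤ Q)
    (hErr : Err ≤ η / 8) :
    1 - (1 - 2 * θ) / (2 * Q) * (κ * N) + (m + 1) / (2 * m) / Q ^ 2 * (N * (2 * m * (Q - s))) + Err / s
      ≤ (1 + η / s) * ((1 + N / s) ^ r * (1 / (1 + N / Q) ^ m)) := by
  have hm' : (1:ℝ) ≤ m := by exact_mod_cast hm
  have hs : 0 < s := by nlinarith
  have hQ : 0 < Q := by linarith
  have b1 : 1 + r * (N / s) ≤ (1 + N / s) ^ r :=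
    one_add_mul_self_le_rpow_one_add (by have : 0 ≤ N / s := by positivity
                                         linarith) hr1
  have b2 : 1 - m * (N / Q) ≤ 1 / (1 + N / Q) ^ m := by
    have h0 : 0 ≤ N / Q := by positivity
    have h1 : 0 < (1 + N / Q) ^ m := by positivity
    rw [le_div_iff₀ h1]
    have h2 : (1 + m * (N/Q)) ≤ (1 + N/Q)^m := one_add_mul_le_pow (by linarith) m
    by_cases hc : 1 - m * (N / Q) ≤ 0
    · nlinarith
    · push Not at hc
      -- (1+x)^m ≤ 1/(1-mx)
      have h3 : 1 + (m:ℝ) * (-(N / Q / (1 + N / Q))) ≤ (1 + (-(N / Q / (1 + N / Q)))) ^ m := by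
        apply one_add_mul_le_pow
        have : N / Q / (1 + N / Q) ≤ 1 := by rw [div_le_one (by positivity)]; linarith
        linarith
      have h4 : 1 + (-(N / Q / (1 + N / Q))) = 1 / (1 + N / Q) := by
        field_simp; ring
      rw [h4, one_div, inv_pow] at h3
      have h5 : N / Q / (1 + N / Q) ≤ N / Q := div_le_self h0 (by linarith)
      have h6 : 1 - m * (N / Q) ≤ ((1 + N / Q) ^ m)⁻¹ := by nlinarith
      calc (1 - m * (N / Q)) * (1 + N / Q) ^ m ≤ ((1 + N / Q) ^ m)⁻¹ * (1 + N / Q) ^ m := by gcongr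
        _ = 1 := inv_mul_cancel₀ h1.ne'
  have hw : 0 ≤ s / Q := by positivity
  have hw1 : s / Q ≤ 1 := by rw [div_le_one hQ]; exact hsQ
  have hmNQ : m * (N / Q) ≤ 1 / 2 := by
    rw [← mul_div_assoc, div_le_iff₀ hQ]; nlinarith
  have hprod : (1 + r * (N / s)) * (1 - m * (N / Q)) ≤ (1 + N / s) ^ r * (1 / (1 + N / Q) ^ m) := by
    apply mul_le_mul b1 b2 (by linarith) (by positivity)
  have hge : 1 / 2 ≤ (1 + r * (N / s)) * (1 - m * (N / Q)) := by
    have : 0 ≤ r * (N / s) := by positivity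
    nlinarith
  have hηs : 0 < η / s := by positivity
  have step1 : (1 + r * (N / s)) * (1 - m * (N / Q)) + η / s * (1 / 2)
      ≤ (1 + η / s) * ((1 + N / s) ^ r * (1 / (1 + N / Q) ^ m)) := by nlinarith
  refine le_trans ?_ step1
  set w := s / Q with hwdef
  have hQw : 1 / Q = w / s := by rw [hwdef]; field_simp
  -- multiply by s
  have key : (1 - (1 - 2 * θ) / (2 * Q) * (κ * N) + (m + 1) / (2 * m) / Q ^ 2 * (N * (2 * m * (Q - s))) + Err / s)
    = 1 + (1 / s) * (-(1 - 2 * θ) * κ / 2 * w * N + (m + 1) * N * (w - w ^ 2) + Err) := by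
    rw [hwdef]; field_simp; ring
  have key2 : (1 + r * (N / s)) * (1 - m * (N / Q)) + η / s * (1 / 2)
    = 1 + (1 / s) * (r * N - m * N * w - r * m * N ^ 2 * w / s + η / 2) := by
    rw [hwdef]; field_simp; ring
  rw [key, key2]
  have hfin : -(1 - 2 * θ) * κ / 2 * w * N + (m + 1) * N * (w - w ^ 2) + Err
      ≤ r * N - m * N * w - r * m * N ^ 2 * w / s + η / 2 := by
    have c1 : r * m * N ^ 2 * w / s ≤ η / 8 := by
      rw [div_le_iff₀ hs]
      have h1 : N ^ 2 * w ≤ Nb ^ 2 :=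
        (mul_le_of_le_one_right (sq_nonneg N) hw1).trans (pow_le_pow_left₀ (by linarith) hNb 2)
      have h0 : 0 ≤ r * m := mul_nonneg (by linarith) (by linarith)
      have h2 := mul_le_mul_of_nonneg_left h1 h0
      calc r * m * N ^ 2 * w = r * m * (N ^ 2 * w) := by ring
        _ ≤ _ := h2.trans hs2
    have c2 : θ * κ * w * N ≤ η / 16 := by
      have h1 : w * N ≤ Nb := (mul_le_of_le_one_left (by linarith) hw1).trans hNb
      have h0 : 0 ≤ θ * κ := by positivity
      calc θ * κ * w * N = θ * κ * (w * N) := by ring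
        _ ≤ _ := (mul_le_mul_of_nonneg_left h1 h0).trans hθη
    have c3 : -((1 + κ / 2) ^ 2 / (4 * (m + 1))) ≤ (m + 1) * w ^ 2 - (2 * m + 1 - κ / 2) * w + (m - κ / 2) := by
      have e : (m + 1) * w ^ 2 - (2 * m + 1 - κ / 2) * w + (m - κ / 2) + (1 + κ / 2) ^ 2 / (4 * (m + 1))
        = (m + 1) * ((1 - w) - (1 + κ / 2) / (2 * (m + 1))) ^ 2 := by
        field_simp; ring
      have : 0 ≤ ((m:ℝ) + 1) * ((1 - w) - (1 + κ / 2) / (2 * (m + 1))) ^ 2 := by positivity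
      linarith
    have c4 : (1 + κ / 2) ^ 2 / (4 * (m + 1)) * N ≤ η / 16 :=
      le_trans (mul_le_mul_of_nonneg_left hNb (by positivity)) hmη
    have c5 := mul_le_mul_of_nonneg_right c3 (show 0 ≤ N by linarith)
    have c6 : r * N = (m - κ / 2) * N := by rw [hr]
    rw [c6]
    linear_combination c1 + c2 + c4 + c5 + hErr + (1 / 8) * hη.le
  have := mul_le_mul_of_nonneg_left hfin (show 0 ≤ 1 / s by positivity)
  linarith

/-- The kernel `p`. -/
noncomputable def awP {d : ℕ} (m : ℕ) (r s : ℝ) (x : EuclideanSpace ℝ (Fin d)) : ℝ :=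
  s ^ r * (1 / (s + ‖x‖ ^ 2 / (2 * m)) ^ m)

end Analytic


section OneStep

lemma aw_Q_expand {d : ℕ} (m : ℕ) (hm : 1 ≤ m) (s : ℝ) (x y : EuclideanSpace ℝ (Fin d)) :
    s + ‖x + y‖ ^ 2 / (2 * m) = (s + ‖x‖ ^ 2 / (2 * m)) + (inner ℝ x y + ‖y‖ ^ 2 / 2) / m := by
  have hm' : (0:ℝ) < m := by exact_mod_cast hm
  rw [norm_add_sq_real]
  field_simp
  ring

lemma aw_inner_sq {d : ℕ} (m : ℕ) (hm : 1 ≤ m) (s : ℝ) (hs : 0 < s) (x y : EuclideanSpace ℝ (Fin d)) :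
    (inner ℝ x y) ^ 2 ≤ 2 * m * (s + ‖x‖ ^ 2 / (2 * m)) * ‖y‖ ^ 2 := by
  have hm' : (0:ℝ) < m := by exact_mod_cast hm
  have h1 : (inner ℝ x y : ℝ) ^ 2 ≤ (‖x‖ * ‖y‖) ^ 2 := sq_le_sq.2 (by
    rw [abs_of_nonneg (show 0 ≤ ‖x‖ * ‖y‖ by positivity)]; exact abs_real_inner_le_norm x y)
  have h2 : 2 * m * (s + ‖x‖ ^ 2 / (2 * m)) = 2 * m * s + ‖x‖ ^ 2 := by field_simp
  rw [h2]
  have : 0 ≤ 2 * m * s * ‖y‖ ^ 2 := by positivity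
  nlinarith

lemma aw_small_int {d : ℕ} (m : ℕ) (hm : 1 ≤ m) (θ : ℝ) (hθ : 0 < θ) (hθ2 : θ ≤ 1 / 2) :
    ∃ δ : ℝ, 0 < δ ∧ δ ≤ 1 ∧ ∃ C : ℝ, 0 < C ∧
    ∀ (κ N : ℝ) (ν : Measure (EuclideanSpace ℝ (Fin d))) [IsProbabilityMeasure ν],
      (∫ y, y ∂ν = 0) → Integrable (fun y => ‖y‖ ^ 2) ν →
      (∀ x, ∫ y, (inner ℝ x y) ^ 2 ∂ν ≤ N * ‖x‖ ^ 2) → (κ * N ≤ ∫ y, ‖y‖ ^ 2 ∂ν) →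
      ∀ s : ℝ, 0 < s → ∀ x : EuclideanSpace ℝ (Fin d),
        ∫ y in {y | ‖y‖ ≤ δ * √s}, 1 / (s + ‖x + y‖ ^ 2 / (2 * m)) ^ m ∂ν
        ≤ 1 / (s + ‖x‖ ^ 2 / (2 * m)) ^ m *
          (1 - (1 - 2 * θ) / (2 * (s + ‖x‖ ^ 2 / (2 * m))) * (κ * N)
            + (m + 1) / (2 * m) / (s + ‖x‖ ^ 2 / (2 * m)) ^ 2 * (N * ‖x‖ ^ 2)
            + (C * ∫ y in {y | ‖y‖ ≤ δ * √s}ᶜ, ‖y‖ ^ 2 ∂ν) / s) := by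
  have hm' : (1:ℝ) ≤ m := by exact_mod_cast hm
  obtain ⟨δ, hδ, hδ1, H⟩ := aw_small_jump' m hm θ hθ
  refine ⟨δ, hδ, hδ1, 2 * m / δ + 1, by positivity, ?_⟩
  intro κ N ν _ hcent hmom hq htr s hs x
  set C := 2 * m / δ + 1 with hC
  set Q := s + ‖x‖ ^ 2 / (2 * m) with hQdef
  have hsQ : s ≤ Q := by rw [hQdef]; have : 0 ≤ ‖x‖ ^ 2 / (2 * m) := by positivity
                         linarith
  have hQ : 0 < Q := by linarith
  set S : Set (EuclideanSpace ℝ (Fin d)) := {y | ‖y‖ ≤ δ * √s} with hS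
  have hSm : MeasurableSet S := measurableSet_le measurable_norm measurable_const
  have hmem : MemLp (fun y : EuclideanSpace ℝ (Fin d) => y) 2 ν := by
    rw [memLp_two_iff_integrable_sq_norm (by fun_prop)]
    exact hmom
  have hIntg : Integrable (fun y : EuclideanSpace ℝ (Fin d) => y) ν := hmem.integrable one_le_two
  have hb : Integrable (fun y => (inner ℝ x y : ℝ)) ν := hIntg.const_inner x
  have hb2 : Integrable (fun y => (inner ℝ x y : ℝ) ^ 2) ν := by
    refine (hmom.const_mul (‖x‖ ^ 2)).mono' (by fun_prop) (Filter.Eventually.of_forall fun y => ?_)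
    rw [Real.norm_of_nonneg (sq_nonneg _), ← mul_pow]
    exact sq_le_sq.2 (by
      rw [abs_of_nonneg (show 0 ≤ ‖x‖ * ‖y‖ by positivity)]; exact abs_real_inner_le_norm x y)
  set Pol : EuclideanSpace ℝ (Fin d) → ℝ := fun y =>
    1 - inner ℝ x y / Q - (1 - 2 * θ) / (2 * Q) * ‖y‖ ^ 2 + (m + 1) / (2 * m) / Q ^ 2 * (inner ℝ x y) ^ 2 with hPol
  have i1 : Integrable (fun y => (1:ℝ) - inner ℝ x y / Q) ν := (integrable_const _).sub (hb.div_const Q)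
  have i2 : Integrable (fun y => (1 - 2 * θ) / (2 * Q) * ‖y‖ ^ 2) ν := hmom.const_mul _
  have i3 : Integrable (fun y => (m + 1) / (2 * m) / Q ^ 2 * (inner ℝ x y : ℝ) ^ 2) ν := hb2.const_mul _
  have hPolint : Integrable Pol ν := (i1.sub i2).add i3
  have hPolval : ∫ y, Pol y ∂ν = 1 - (1 - 2 * θ) / (2 * Q) * ∫ y, ‖y‖ ^ 2 ∂ν
      + (m + 1) / (2 * m) / Q ^ 2 * ∫ y, (inner ℝ x y) ^ 2 ∂ν := by
    have e1 : ∫ y, (inner ℝ x y : ℝ) ∂ν = 0 := by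
      rw [integral_inner hIntg x, hcent, inner_zero_right]
    have i12 : Integrable (fun y => (1:ℝ) - inner ℝ x y / Q - (1 - 2 * θ) / (2 * Q) * ‖y‖ ^ 2) ν := i1.sub i2
    simp only [hPol]
    rw [integral_add i12 i3, integral_sub i1 i2, integral_sub (integrable_const _) (hb.div_const Q),
      integral_div, e1, integral_const_mul, integral_const_mul]
    simp
  -- small part
  have hsmall : ∫ y in S, 1 / (s + ‖x + y‖ ^ 2 / (2 * m)) ^ m ∂ν ≤ ∫ y in S, 1 / Q ^ m * Pol y ∂ν := by
    refine setIntegral_mono_on ?_ ((hPolint.const_mul _).integrableOn) hSm ?_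
    · refine Integrable.integrableOn ?_
      refine (integrable_const (1 / s ^ m)).mono' ?_ (Filter.Eventually.of_forall fun y => ?_)
      · exact Measurable.aestronglyMeasurable (by fun_prop)
      · rw [Real.norm_of_nonneg (by positivity)]
        have : 0 ≤ ‖x + y‖ ^ 2 / (2 * m) := by positivity
        gcongr
        linarith
    · intro y hy
      rw [aw_Q_expand m hm]
      apply H Q (inner ℝ x y) ‖y‖ hQ (aw_inner_sq m hm s hs x y)
      have hy' : ‖y‖ ≤ δ * √s := hy
      calc ‖y‖ ^ 2 ≤ (δ * √s) ^ 2 := pow_le_pow_left₀ (norm_nonneg _) hy' 2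
        _ = δ ^ 2 * s := by rw [mul_pow, Real.sq_sqrt hs.le]
        _ ≤ δ ^ 2 * Q := by gcongr
  have hbig : - ∫ y in Sᶜ, Pol y ∂ν ≤ (C * ∫ y in Sᶜ, ‖y‖ ^ 2 ∂ν) / s := by
    rw [← integral_neg, ← integral_const_mul, ← integral_div]
    refine setIntegral_mono_on hPolint.neg.integrableOn ((hmom.const_mul C).div_const s).integrableOn hSm.compl ?_
    intro y hy
    have hy' : δ * √s < ‖y‖ := not_le.1 hy
    have hy2 : δ ^ 2 * s ≤ ‖y‖ ^ 2 := by
      calc δ ^ 2 * s = (δ * √s) ^ 2 := by rw [mul_pow, Real.sq_sqrt hs.le]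
        _ ≤ _ := pow_le_pow_left₀ (by positivity) hy'.le 2
    have hB := aw_inner_sq m hm s hs x y
    rw [← hQdef] at hB
    have h1 : |(inner ℝ x y : ℝ) / Q| ≤ 2 * m / δ * ‖y‖ ^ 2 / s := by
      apply abs_le_of_sq_le_sq _ (by positivity)
      calc ((inner ℝ x y : ℝ) / Q) ^ 2 ≤ (2 * m * Q * ‖y‖ ^ 2) / Q ^ 2 := by
            rw [div_pow]; gcongr
        _ = 2 * m * ‖y‖ ^ 2 / Q := by field_simp
        _ ≤ 2 * m * ‖y‖ ^ 2 / s := by gcongr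
        _ = 2 * m / (δ ^ 2) * (δ ^ 2 * s) * ‖y‖ ^ 2 / s ^ 2 := by field_simp
        _ ≤ 2 * m / (δ ^ 2) * (‖y‖ ^ 2) * ‖y‖ ^ 2 / s ^ 2 := by gcongr
        _ ≤ (2 * m) ^ 2 / (δ ^ 2) * (‖y‖ ^ 2) * ‖y‖ ^ 2 / s ^ 2 := by
            gcongr; nlinarith
        _ = _ := by field_simp
    have h2 : (1 - 2 * θ) / (2 * Q) * ‖y‖ ^ 2 ≤ ‖y‖ ^ 2 / s := by
      rw [div_mul_eq_mul_div]
      apply div_le_div₀ (by positivity) _ hs (by linarith)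
      nlinarith [sq_nonneg ‖y‖]
    have h3 : 0 ≤ (m + 1) / (2 * m) / Q ^ 2 * (inner ℝ x y : ℝ) ^ 2 := by positivity
    have h4 := le_abs_self ((inner ℝ x y : ℝ) / Q)
    have h5 : C * ‖y‖ ^ 2 / s = 2 * m / δ * ‖y‖ ^ 2 / s + ‖y‖ ^ 2 / s := by rw [hC]; ring
    simp only [hPol]
    rw [h5]
    linarith
  have hsplit := integral_add_compl hSm hPolint
  refine hsmall.trans ?_
  rw [integral_const_mul]
  apply mul_le_mul_of_nonneg_left _ (by positivity)
  have h6 : (1 - 2 * θ) / (2 * Q) * (κ * N) ≤ (1 - 2 * θ) / (2 * Q) * ∫ y, ‖y‖ ^ 2 ∂ν := by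
    apply mul_le_mul_of_nonneg_left htr
    apply div_nonneg <;> linarith
  have h7 : (m + 1) / (2 * m) / Q ^ 2 * ∫ y, (inner ℝ x y) ^ 2 ∂ν ≤ (m + 1) / (2 * m) / Q ^ 2 * (N * ‖x‖ ^ 2) := by
    apply mul_le_mul_of_nonneg_left (hq x) (by positivity)
  linarith

lemma awP_ratio {d : ℕ} (m : ℕ) (r s N : ℝ) (hs : 0 < s) (hN : 0 ≤ N) (x : EuclideanSpace ℝ (Fin d)) :
    awP m r (s + N) x = awP m r s x *
      ((1 + N / s) ^ r * (1 / (1 + N / (s + ‖x‖ ^ 2 / (2 * m))) ^ m)) := by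
  unfold awP
  have hQ : 0 < s + ‖x‖ ^ 2 / (2 * m) := by positivity
  set Q := s + ‖x‖ ^ 2 / (2 * m) with hQd
  have e1 : s + N + ‖x‖ ^ 2 / (2 * m) = Q * (1 + N / Q) := by
    have : Q * (1 + N / Q) = Q + N := by field_simp
    rw [this, hQd]; ring
  have e2 : s + N = s * (1 + N / s) := by field_simp
  rw [e1, e2, Real.mul_rpow hs.le (by positivity), mul_pow, ← one_div_mul_one_div]
  ring

set_option maxHeartbeats 1000000 in
lemma aw_onestep {d : ℕ} (κ η Nb : ℝ) (hκ : 0 < κ) (hη : 0 < η) (hNb : 1 ≤ Nb) :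
    ∃ m : ℕ, 1 ≤ m ∧ 1 ≤ (m : ℝ) - κ / 2 ∧ ∃ δ : ℝ, 0 < δ ∧ ∃ τ : ℝ, 0 < τ ∧ τ ≤ η * δ ^ 2 ∧
    ∃ s1 : ℝ, 1 ≤ s1 ∧
    ∀ (N : ℝ) (ν : Measure (EuclideanSpace ℝ (Fin d))) [IsProbabilityMeasure ν],
      1 ≤ N → N ≤ Nb →
      (∫ y, y ∂ν = 0) → Integrable (fun y => ‖y‖ ^ 2) ν →
      (∀ x, ∫ y, (inner ℝ x y) ^ 2 ∂ν ≤ N * ‖x‖ ^ 2) → (κ * N ≤ ∫ y, ‖y‖ ^ 2 ∂ν) →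
      ∀ s : ℝ, s1 ≤ s → ∫ y in {y | ‖y‖ ≤ δ * √s}ᶜ, ‖y‖ ^ 2 ∂ν ≤ τ →
      ∀ x : EuclideanSpace ℝ (Fin d),
        (∫ y in {y | ‖y‖ ≤ δ * √s}, awP m (m - κ / 2) s (x + y) ∂ν
          ≤ (1 + η / s) * awP m (m - κ / 2) (s + N) x) ∧
        awP m (m - κ / 2) s x ≤ 2 * awP m (m - κ / 2) (s + N) x := by
  obtain ⟨m, hm⟩ := exists_nat_ge (κ / 2 + 1 + (1 + κ / 2) ^ 2 * Nb * 4 / η)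
  have hpos1 : 0 ≤ (1 + κ / 2) ^ 2 * Nb * 4 / η := by positivity
  have hm1r : (1:ℝ) ≤ m := by linarith
  have hm1 : 1 ≤ m := by exact_mod_cast hm1r
  have hmη : (1 + κ / 2) ^ 2 / (4 * ((m:ℝ) + 1)) * Nb ≤ η / 16 := by
    have : (1 + κ / 2) ^ 2 * Nb * 4 / η ≤ m := by linarith
    rw [div_le_iff₀ hη] at this
    rw [div_mul_eq_mul_div, div_le_iff₀ (by positivity)]
    nlinarith
  set θ : ℝ := min (1 / 2) (η / (16 * κ * Nb)) with hθd
  have hθ : 0 < θ := lt_min (by norm_num) (by positivity)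
  have hθ2 : θ ≤ 1 / 2 := min_le_left _ _
  have hθη : θ * κ * Nb ≤ η / 16 := by
    have : θ ≤ η / (16 * κ * Nb) := min_le_right _ _
    rw [le_div_iff₀ (by positivity)] at this
    linarith
  obtain ⟨δ, hδ, hδ1, C, hC, H⟩ := aw_small_int (d := d) m hm1 θ hθ hθ2
  set r : ℝ := m - κ / 2 with hr
  have hr1 : 1 ≤ r := by linarith
  refine ⟨m, hm1, hr1, δ, hδ, min (η * δ ^ 2) (η / 8 / C), lt_min (by positivity) (by positivity),
    min_le_left _ _, max 1 (max (2 * m * Nb) (r * m * Nb ^ 2 / (η / 8))), le_max_left _ _, ?_⟩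
  intro N ν _ hN hNNb hcent hmom hq htr s hs hτ x
  have hs1 : 2 * m * Nb ≤ s := ((le_max_left _ _).trans (le_max_right _ _)).trans hs
  have hs2 : r * m * Nb ^ 2 ≤ η / 8 * s := by
    have : r * m * Nb ^ 2 / (η / 8) ≤ s := ((le_max_right _ _).trans (le_max_right _ _)).trans hs
    rw [div_le_iff₀ (by positivity)] at this
    linarith
  have hs0 : 1 ≤ s := (le_max_left _ _).trans hs
  have hsp : 0 < s := by linarith
  set Q := s + ‖x‖ ^ 2 / (2 * m) with hQd
  have hsQ : s ≤ Q := by rw [hQd]; have : 0 ≤ ‖x‖ ^ 2 / (2 * m) := by positivity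
                         linarith
  have hQ : 0 < Q := by linarith
  have hErr : C * ∫ y in {y | ‖y‖ ≤ δ * √s}ᶜ, ‖y‖ ^ 2 ∂ν ≤ η / 8 := by
    have := hτ.trans (min_le_right _ _)
    rw [le_div_iff₀ hC] at this
    linarith
  have hx : ‖x‖ ^ 2 = 2 * m * (Q - s) := by rw [hQd]; field_simp; ring
  have key := aw_scalar m κ θ η N Nb s Q r _ hm1 hκ.le hθ hη hN hNNb hr hr1 hmη hθη hs1 hs2 hsQ hErr
  have hpp : 0 < awP m r s x := by unfold awP; positivity
  constructor
  · rw [awP_ratio m r s N hsp (by linarith) x, ← hQd]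
    have h1 := H κ N ν hcent hmom hq htr s hsp x
    rw [← hQd] at h1
    have h2 : ∫ y in {y | ‖y‖ ≤ δ * √s}, awP m r s (x + y) ∂ν
        = s ^ r * ∫ y in {y | ‖y‖ ≤ δ * √s}, 1 / (s + ‖x + y‖ ^ 2 / (2 * m)) ^ m ∂ν := by
      unfold awP
      rw [integral_const_mul]
    rw [h2]
    rw [hx] at h1
    have h3 := h1.trans (mul_le_mul_of_nonneg_left key (by positivity))
    have h4 := mul_le_mul_of_nonneg_left h3 (show 0 ≤ s ^ r by positivity)
    refine h4.trans (le_of_eq ?_)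
    unfold awP
    rw [← hQd]
    ring
  · rw [awP_ratio m r s N hsp (by linarith) x, ← hQd]
    have h1 : 1 ≤ (1 + N / s) ^ r := Real.one_le_rpow (by have : 0 ≤ N / s := by positivity
                                                          linarith) (by linarith)
    have h2 : (1 + N / Q) ^ m ≤ 2 := by
      have h0 : N / Q ≤ 1 / (2 * m) := by
        rw [div_le_div_iff₀ hQ (by positivity)]
        nlinarith
      have h3 : 1 + (m:ℝ) * (-(1 / (2 * m) )) ≤ (1 + (-(1 / (2 * m)))) ^ m := by
        apply one_add_mul_le_pow
        have : 1 / (2 * (m:ℝ)) ≤ 1 := by rw [div_le_one (by positivity)]; linarith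
        linarith
      have h4 : 1 + (m:ℝ) * (-(1 / (2 * m) )) = 1 / 2 := by field_simp; ring
      rw [h4] at h3
      have h5 : (1 + N / Q) ^ m * (1 + (-(1 / (2 * (m:ℝ))))) ^ m ≤ 1 := by
        rw [← mul_pow]
        have hh : 1 / (2 * (m:ℝ)) ≤ 1 := by rw [div_le_one (by positivity)]; linarith
        have h00 : 0 ≤ N / Q := by positivity
        apply pow_le_one₀
        · apply mul_nonneg <;> linarith
        · nlinarith
      have h6 : 0 < (1 + N / Q) ^ m := by positivity
      have h7 := mul_le_mul_of_nonneg_left h3 h6.le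
      linarith
    have h3 : 1 / 2 ≤ 1 / (1 + N / Q) ^ m := by
      apply one_div_le_one_div_of_le _ h2
      positivity
    have h4 : 1 * (1 / 2) ≤ (1 + N / s) ^ r * (1 / (1 + N / Q) ^ m) :=
      mul_le_mul h1 h3 (by norm_num) (by linarith)
    have h5 := mul_le_mul_of_nonneg_left h4 hpp.le
    linarith

end OneStep


section Conv

lemma aw_tail {d : ℕ} (ν : Measure (EuclideanSpace ℝ (Fin d)))
    (hmom : Integrable (fun y => ‖y‖ ^ 2) ν) (δ τ : ℝ) (hδ : 0 < δ) (hτ : 0 < τ) :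
    ∃ n0 : ℕ, ∀ n : ℕ, n0 ≤ n → ∫ y in {y | ‖y‖ ≤ δ * √(n:ℝ)}ᶜ, ‖y‖ ^ 2 ∂ν ≤ τ := by
  have hmeas : ∀ n : ℕ, MeasurableSet ({y : EuclideanSpace ℝ (Fin d) | ‖y‖ ≤ δ * √(n:ℝ)}ᶜ) := fun n =>
    (measurableSet_le measurable_norm measurable_const).compl
  have hanti : Antitone (fun n : ℕ => ({y : EuclideanSpace ℝ (Fin d) | ‖y‖ ≤ δ * √(n:ℝ)}ᶜ)) := by
    intro a b hab
    apply Set.compl_subset_compl.2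
    intro y hy
    have hy' : ‖y‖ ≤ δ * √(a:ℝ) := hy
    exact hy'.trans (by gcongr)
  have ht := tendsto_setIntegral_of_antitone (μ := ν) (f := fun y => ‖y‖ ^ 2) hmeas hanti ⟨0, hmom.integrableOn⟩
  have hempty : (⋂ n : ℕ, ({y : EuclideanSpace ℝ (Fin d) | ‖y‖ ≤ δ * √(n:ℝ)}ᶜ)) = ∅ := by
    ext y
    simp only [Set.mem_iInter, Set.mem_compl_iff, Set.mem_empty_iff_false, iff_false, not_forall, not_not]
    obtain ⟨n, hn⟩ := exists_nat_ge ((‖y‖ / δ) ^ 2)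
    refine ⟨n, ?_⟩
    have : ‖y‖ / δ ≤ √(n:ℝ) := Real.le_sqrt_of_sq_le hn
    rw [div_le_iff₀ hδ] at this
    show ‖y‖ ≤ δ * √(n:ℝ)
    linarith
  rw [hempty, Measure.restrict_empty, integral_zero_measure] at ht
  obtain ⟨n0, h⟩ := Filter.eventually_atTop.1 (ht.eventually (ge_mem_nhds hτ))
  exact ⟨n0, h⟩

lemma aw_tail_mass {d : ℕ} (ν : Measure (EuclideanSpace ℝ (Fin d))) [IsProbabilityMeasure ν]
    (hmom : Integrable (fun y => ‖y‖ ^ 2) ν) (δ τ η s : ℝ) (hδ : 0 < δ) (hs : 0 < s)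
    (hτ : τ ≤ η * δ ^ 2) (h : ∫ y in {y | ‖y‖ ≤ δ * √s}ᶜ, ‖y‖ ^ 2 ∂ν ≤ τ) :
    ν ({y | ‖y‖ ≤ δ * √s}ᶜ) ≤ ENNReal.ofReal (η / s) := by
  have hm : MeasurableSet ({y : EuclideanSpace ℝ (Fin d) | ‖y‖ ≤ δ * √s}ᶜ) :=
    (measurableSet_le measurable_norm measurable_const).compl
  have h1 : ∫ y in {y : EuclideanSpace ℝ (Fin d) | ‖y‖ ≤ δ * √s}ᶜ, (δ ^ 2 * s) ∂ν
      ≤ ∫ y in {y | ‖y‖ ≤ δ * √s}ᶜ, ‖y‖ ^ 2 ∂ν := by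
    refine setIntegral_mono_on (integrable_const _).integrableOn hmom.integrableOn hm ?_
    intro y hy
    have hy' : δ * √s < ‖y‖ := not_le.1 hy
    calc δ ^ 2 * s = (δ * √s) ^ 2 := by rw [mul_pow, Real.sq_sqrt hs.le]
      _ ≤ _ := pow_le_pow_left₀ (by positivity) hy'.le 2
  rw [setIntegral_const, smul_eq_mul] at h1
  rw [← ENNReal.ofReal_toReal (measure_ne_top ν _)]
  apply ENNReal.ofReal_le_ofReal
  change ν.real _ ≤ _
  rw [le_div_iff₀ hs]
  have h2 := (h1.trans h).trans hτ
  have h3 : ν.real {y | ‖y‖ ≤ δ * √s}ᶜ * s * δ ^ 2 ≤ η * δ ^ 2 := by linarith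
  exact le_of_mul_le_mul_right h3 (by positivity)

lemma aw_growth (a s : ℝ) (ha : 0 ≤ a) (hs : 1 ≤ s) :
    s ^ (2 * a) * (1 + a / s) ≤ (s + 1) ^ (2 * a) := by
  have hs0 : 0 < s := by linarith
  have e : s + 1 = s * (1 + 1 / s) := by field_simp
  rw [e, Real.mul_rpow hs0.le (by positivity)]
  apply mul_le_mul_of_nonneg_left _ (by positivity)
  have h1 : 1 + a / s ≤ Real.exp (a / s) := by have := Real.add_one_le_exp (a / s); linarith
  refine h1.trans ?_
  rw [Real.rpow_def_of_pos (by positivity)]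
  apply Real.exp_le_exp.2
  have h2 : 1 - (1 + 1 / s)⁻¹ ≤ Real.log (1 + 1 / s) := Real.one_sub_inv_le_log_of_pos (by positivity)
  have h3 : 1 / (2 * s) ≤ 1 - (1 + 1 / s)⁻¹ := by
    have : 1 - (1 + 1 / s)⁻¹ = 1 / (s + 1) := by field_simp; ring
    rw [this]
    apply one_div_le_one_div_of_le <;> linarith
  calc a / s = 1 / (2 * s) * (2 * a) := by field_simp
    _ ≤ _ := mul_le_mul_of_nonneg_right (h3.trans h2) (by positivity)

/-- Iterated convolutions. -/
noncomputable def awR {d : ℕ} (ρ : ℕ → Measure (EuclideanSpace ℝ (Fin d))) : ℕ → Measure (EuclideanSpace ℝ (Fin d))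
  | 0 => Measure.dirac 0
  | n + 1 => Measure.conv (awR ρ n) (ρ n)

lemma awP_meas {d : ℕ} (m : ℕ) (r s : ℝ) : Measurable (awP (d := d) m r s) := by
  unfold awP; fun_prop

lemma awP_le {d : ℕ} (m : ℕ) (κ s : ℝ) (hs : 0 < s) (x : EuclideanSpace ℝ (Fin d)) :
    awP m (m - κ / 2) s x ≤ s ^ (-(κ / 2)) := by
  unfold awP
  have h1 : 1 / (s + ‖x‖ ^ 2 / (2 * m)) ^ m ≤ 1 / s ^ m := by
    have : 0 ≤ ‖x‖ ^ 2 / (2 * m) := by positivity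
    gcongr
    linarith
  calc _ ≤ s ^ ((m:ℝ) - κ / 2) * (1 / s ^ m) := by gcongr
    _ = _ := by
      rw [sub_eq_add_neg, Real.rpow_add hs, Real.rpow_natCast]
      field_simp

set_option maxHeartbeats 1000000 in
lemma aw_super {d ℓ : ℕ} (ν : Fin ℓ → Measure (EuclideanSpace ℝ (Fin d)))
    [∀ i, IsProbabilityMeasure (ν i)] (N : Fin ℓ → ℕ) (hN : ∀ i, 1 ≤ N i) (κ η : ℝ)
    (hκ : 0 < κ) (hη : 0 < η) (hηκ : η ≤ κ / 2)
    (hcent : ∀ i, ∫ y, y ∂(ν i) = 0) (hmom : ∀ i, Integrable (fun y => ‖y‖ ^ 2) (ν i))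
    (hq : ∀ i x, ∫ y, (inner ℝ x y) ^ 2 ∂(ν i) ≤ N i * ‖x‖ ^ 2)
    (htr : ∀ i, κ * N i ≤ ∫ y, ‖y‖ ^ 2 ∂(ν i)) :
    ∃ G : ℕ → EuclideanSpace ℝ (Fin d) → ENNReal, (∀ s, Measurable (G s)) ∧
      (∀ s i x, ∫⁻ y, G s (x + y) ∂(ν i) ≤ G (s + N i) x) ∧
      (∀ s x, G s x ≤ ENNReal.ofReal (((s:ℝ) + 1) ^ (-(κ / 2) + η))) ∧
      (∀ R : ℝ, ∃ c : ℝ, 0 < c ∧ ∀ x, ‖x‖ ≤ R → ENNReal.ofReal c ≤ G 0 x) := by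
  set η1 : ℝ := η / (2 * (1 + 2 * ℓ)) with hη1d
  have hη1 : 0 < η1 := by positivity
  have hη2 : 2 * ((1 + 2 * ℓ) * η1) = η := by rw [hη1d]; field_simp
  set Nb : ℝ := 1 + ∑ i, (N i : ℝ) with hNbd
  have hNb1 : 1 ≤ Nb := by
    have : 0 ≤ ∑ i, (N i : ℝ) := Finset.sum_nonneg (fun i _ => by positivity)
    linarith
  have hNNb : ∀ i, (N i : ℝ) ≤ Nb := by
    intro i
    have := Finset.single_le_sum (f := fun i => (N i : ℝ)) (fun i _ => by positivity) (Finset.mem_univ i)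
    linarith
  obtain ⟨m, hm, hr1, δ, hδ, τ, hτ, hτ2, s1, hs1, H⟩ := aw_onestep (d := d) κ η1 Nb hκ hη1 hNb1
  choose n0 hn0 using fun i => aw_tail (ν i) (hmom i) δ τ hδ hτ
  obtain ⟨s1n, hs1n⟩ := exists_nat_ge s1
  set s0 : ℕ := s1n + ∑ i, n0 i with hs0d
  have hs0r : s1 ≤ (s0:ℝ) := hs1n.trans (by rw [hs0d]; push_cast; have : 0 ≤ ∑ i, (n0 i:ℝ) := Finset.sum_nonneg (fun i _ => by positivity)
                                            linarith)
  have hs0i : ∀ i, n0 i ≤ s0 := by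
    intro i
    have := Finset.single_le_sum (f := n0) (fun i _ => Nat.zero_le _) (Finset.mem_univ i)
    omega
  set r : ℝ := (m:ℝ) - κ / 2 with hr
  let σ : ℕ → ℝ := fun s => ((s + s0 : ℕ) : ℝ)
  have hσ1 : ∀ s, s1 ≤ σ s := fun s => by
    simp only [σ]; push_cast; have : (0:ℝ) ≤ s := by positivity
    linarith
  have hσ11 : ∀ s, 1 ≤ σ s := fun s => hs1.trans (hσ1 s)
  have hσ0 : ∀ s, 0 < σ s := fun s => by linarith [hσ11 s]
  have hσtail : ∀ s i, ∫ y in {y | ‖y‖ ≤ δ * √(σ s)}ᶜ, ‖y‖ ^ 2 ∂(ν i) ≤ τ := fun s i =>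
    hn0 i (s + s0) ((hs0i i).trans (by omega))
  have hσN : ∀ s i, σ (s + N i) = σ s + N i := fun s i => by simp only [σ]; push_cast; ring
  let big : ℕ → Set (EuclideanSpace ℝ (Fin d)) := fun s => {y | ‖y‖ ≤ δ * √(σ s)}ᶜ
  have hbig : ∀ s, MeasurableSet (big s) := fun s =>
    (measurableSet_le measurable_norm measurable_const).compl
  let q : ℕ → EuclideanSpace ℝ (Fin d) → ENNReal := fun s x => ENNReal.ofReal (awP m r (σ s) x)
  have hqm : ∀ s, Measurable (q s) := fun s => (awP_meas m r (σ s)).ennreal_ofReal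
  let ρ : ℕ → Measure (EuclideanSpace ℝ (Fin d)) := fun s =>
    ENNReal.ofReal (1 + η1 / σ s) • Measure.dirac 0 + ∑ i, (2 : ENNReal) • (ν i).restrict (big s)
  have hρint : ∀ s (f : EuclideanSpace ℝ (Fin d) → ENNReal), Measurable f →
      ∫⁻ y, f y ∂(ρ s) = ENNReal.ofReal (1 + η1 / σ s) * f 0 + ∑ i, 2 * ∫⁻ y in big s, f y ∂(ν i) := by
    intro s f hf
    simp only [ρ]
    rw [lintegral_add_measure, lintegral_smul_measure, lintegral_dirac' _ hf, lintegral_finsetSum_measure]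
    simp only [lintegral_smul_measure, smul_eq_mul]
  have hρmass : ∀ s, ρ s Set.univ ≤ ENNReal.ofReal (1 + ((1 + 2 * ℓ) * η1) / σ s) := by
    intro s
    have h1 := hρint s (fun _ => 1) measurable_const
    rw [lintegral_one] at h1
    rw [h1]
    simp only [mul_one, lintegral_one, Measure.restrict_apply_univ]
    have h2 : ∀ i, (2:ENNReal) * ν i (big s) ≤ ENNReal.ofReal (2 * (η1 / σ s)) := by
      intro i
      rw [ENNReal.ofReal_mul (by norm_num)]
      have := aw_tail_mass (ν i) (hmom i) δ τ η1 (σ s) hδ (hσ0 s) hτ2 (hσtail s i)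
      simp only [ENNReal.ofReal_ofNat]
      gcongr
    calc _ ≤ ENNReal.ofReal (1 + η1 / σ s) + ∑ i : Fin ℓ, ENNReal.ofReal (2 * (η1 / σ s)) := by
          gcongr with i _; exact h2 i
      _ = _ := by
        have hp : 0 < η1 / σ s := div_pos hη1 (hσ0 s)
        rw [← ENNReal.ofReal_sum_of_nonneg (fun i _ => by positivity), ← ENNReal.ofReal_add (by positivity)
          (Finset.sum_nonneg (fun i _ => by positivity))]
        congr 1
        simp
        ring
  have hρfin : ∀ s, IsFiniteMeasure (ρ s) := fun s => ⟨(hρmass s).trans_lt ENNReal.ofReal_lt_top⟩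
  have hRfin : ∀ s, IsFiniteMeasure (awR ρ s) := by
    intro s
    induction s with
    | zero => simp only [awR]; infer_instance
    | succ s ih => simp only [awR]; infer_instance
  have hRsucc : ∀ s (f : EuclideanSpace ℝ (Fin d) → ENNReal), Measurable f →
      ∫⁻ z, f z ∂(awR ρ (s + 1)) = ∫⁻ y, ∫⁻ w, f (y + w) ∂(ρ s) ∂(awR ρ s) := by
    intro s f hf
    simp only [awR]
    exact Measure.lintegral_conv hf
  have hRmass : ∀ s, awR ρ s Set.univ ≤ ENNReal.ofReal ((σ s) ^ η) := by
    intro s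
    induction s with
    | zero =>
      simp only [awR, measure_univ]
      rw [← ENNReal.ofReal_one]
      exact ENNReal.ofReal_le_ofReal (Real.one_le_rpow (hσ11 0) hη.le)
    | succ s ih =>
      have h1 := hRsucc s (fun _ => 1) measurable_const
      simp only [lintegral_one, lintegral_const] at h1
      rw [h1]
      calc _ ≤ ENNReal.ofReal (1 + ((1 + 2 * ℓ) * η1) / σ s) * ENNReal.ofReal ((σ s) ^ η) := by
            gcongr; exact hρmass s
        _ = ENNReal.ofReal ((σ s) ^ η * (1 + ((1 + 2 * ℓ) * η1) / σ s)) := by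
            rw [← ENNReal.ofReal_mul, mul_comm]
            have := hσ0 s; positivity
        _ ≤ _ := by
            apply ENNReal.ofReal_le_ofReal
            have h2 := aw_growth ((1 + 2 * ℓ) * η1) (σ s) (by positivity) (hσ11 s)
            rw [hη2] at h2
            have h3 : σ (s + 1) = σ s + 1 := by simp only [σ]; push_cast; ring
            rw [h3]; exact h2
  have hRmono1 : ∀ s (f : EuclideanSpace ℝ (Fin d) → ENNReal), Measurable f →
      ∫⁻ z, f z ∂(awR ρ s) ≤ ∫⁻ z, f z ∂(awR ρ (s + 1)) := by
    intro s f hf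
    rw [hRsucc s f hf]
    refine lintegral_mono (fun y => ?_)
    rw [hρint s (fun w => f (y + w)) (hf.comp (measurable_const_add y))]
    refine le_trans ?_ le_self_add
    rw [add_zero]
    apply le_mul_of_one_le_left zero_le
    rw [← ENNReal.ofReal_one]
    apply ENNReal.ofReal_le_ofReal
    have : 0 < η1 / σ s := div_pos hη1 (hσ0 s)
    linarith
  have hRmono : ∀ (f : EuclideanSpace ℝ (Fin d) → ENNReal), Measurable f → Monotone (fun s => ∫⁻ z, f z ∂(awR ρ s)) :=
    fun f hf => monotone_nat_of_le_succ (fun s => hRmono1 s f hf)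
  -- one step
  have hone : ∀ s i x, ∫⁻ y, q s (x + y) ∂(ν i) ≤ ∫⁻ y, q (s + N i) (x + y) ∂(ρ s) := by
    intro s i x
    have HH := H (N i) (ν i) (by exact_mod_cast hN i) (hNNb i) (hcent i) (hmom i) (hq i) (htr i) (σ s) (hσ1 s) (hσtail s i)
    rw [hρint s (fun y => q (s + N i) (x + y)) ((hqm _).comp (measurable_const_add x)), add_zero,
      ← lintegral_add_compl (fun y => q s (x + y)) (hbig s),
      add_comm (∫⁻ y in big s, q s (x + y) ∂(ν i))]
    apply add_le_add
    · simp only [big, compl_compl, q]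
      rw [← ofReal_integral_eq_lintegral_ofReal, ← ENNReal.ofReal_mul, hσN]
      · exact ENNReal.ofReal_le_ofReal (HH x).1
      · have := hσ0 s; positivity
      · refine Integrable.integrableOn ?_
        refine (integrable_const ((σ s) ^ (-(κ / 2)))).mono' ?_ (Filter.Eventually.of_forall fun y => ?_)
        · exact ((awP_meas m r (σ s)).comp (measurable_const_add x)).aestronglyMeasurable
        · have h0 : 0 ≤ awP m r (σ s) (x + y) := by have := hσ0 s; unfold awP; positivity
          rw [Real.norm_of_nonneg h0]
          exact awP_le m κ _ (hσ0 s) _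
      · refine Filter.Eventually.of_forall fun y => ?_
        have := hσ0 s; show 0 ≤ awP m r (σ s) (x + y); unfold awP; positivity
    · have h1 : ∫⁻ y in big s, q s (x + y) ∂(ν i) ≤ 2 * ∫⁻ y in big s, q (s + N i) (x + y) ∂(ν i) := by
        rw [← lintegral_const_mul (f := fun y => q (s + N i) (x + y)) _ ((hqm _).comp (measurable_const_add x))]
        refine lintegral_mono (fun y => ?_)
        simp only [q]
        rw [hσN]
        calc _ ≤ ENNReal.ofReal (2 * awP m r (σ s + N i) (x + y)) := ENNReal.ofReal_le_ofReal (HH (x + y)).2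
          _ = _ := by rw [ENNReal.ofReal_mul (by norm_num)]; simp
      exact h1.trans (Finset.single_le_sum (f := fun j => 2 * ∫⁻ y in big s, q (s + N i) (x + y) ∂(ν j))
        (fun _ _ => zero_le) (Finset.mem_univ i))
  have hjoint : ∀ s, Measurable (fun p : EuclideanSpace ℝ (Fin d) × EuclideanSpace ℝ (Fin d) => q s (p.1 + p.2)) :=
    fun s => (hqm s).comp measurable_add
  refine ⟨fun s x => ∫⁻ y, q s (x + y) ∂(awR ρ s), ?_, ?_, ?_, ?_⟩
  · intro s
    exact (hjoint s).lintegral_prod_right'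
  · intro s i x
    calc ∫⁻ y, ∫⁻ z, q s (x + y + z) ∂(awR ρ s) ∂(ν i)
        = ∫⁻ z, ∫⁻ y, q s (x + y + z) ∂(ν i) ∂(awR ρ s) := by
          apply lintegral_lintegral_swap
          refine Measurable.aemeasurable ?_
          exact (hqm s).comp (((measurable_const_add x).comp measurable_fst).add measurable_snd)
      _ ≤ ∫⁻ z, ∫⁻ w, q (s + N i) (x + (z + w)) ∂(ρ s) ∂(awR ρ s) := by
          refine lintegral_mono (fun z => ?_)
          have := hone s i (x + z)
          simpa only [add_assoc, add_comm, add_left_comm] using this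
      _ = ∫⁻ z, q (s + N i) (x + z) ∂(awR ρ (s + 1)) :=
          (hRsucc s (fun z => q (s + N i) (x + z)) ((hqm _).comp (measurable_const_add x))).symm
      _ ≤ ∫⁻ z, q (s + N i) (x + z) ∂(awR ρ (s + N i)) :=
          hRmono (fun z => q (s + N i) (x + z)) ((hqm _).comp (measurable_const_add x)) (by have := hN i; omega)
  · intro s x
    calc ∫⁻ y, q s (x + y) ∂(awR ρ s) ≤ ∫⁻ y, ENNReal.ofReal ((σ s) ^ (-(κ / 2))) ∂(awR ρ s) :=
          lintegral_mono (fun y => ENNReal.ofReal_le_ofReal (awP_le m κ _ (hσ0 s) _))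
      _ = ENNReal.ofReal ((σ s) ^ (-(κ / 2))) * awR ρ s Set.univ := lintegral_const _
      _ ≤ ENNReal.ofReal ((σ s) ^ (-(κ / 2))) * ENNReal.ofReal ((σ s) ^ η) := by gcongr; exact hRmass s
      _ = ENNReal.ofReal ((σ s) ^ (-(κ / 2) + η)) := by
          rw [← ENNReal.ofReal_mul (by have := hσ0 s; positivity), Real.rpow_add (hσ0 s)]
      _ ≤ _ := by
          apply ENNReal.ofReal_le_ofReal
          apply Real.rpow_le_rpow_of_nonpos (by positivity) _ (by linarith)
          have : (1:ℝ) ≤ s0 := hs1.trans hs0r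
          simp only [σ]; push_cast; linarith
  · intro R
    have hσ := hσ0 0
    refine ⟨(σ 0) ^ r * (1 / (σ 0 + R ^ 2 / (2 * m)) ^ m), by positivity, fun x hx => ?_⟩
    simp only [awR]
    rw [lintegral_dirac' (f := fun y => q 0 (x + y)) _ ((hqm _).comp (measurable_const_add x)), add_zero]
    apply ENNReal.ofReal_le_ofReal
    unfold awP
    gcongr

end Conv


section Prob

lemma aw_rect {Ω : Type} [MeasureSpace Ω] [IsProbabilityMeasure (ℙ : Measure Ω)] {d ℓ : ℕ}
    {F : ℕ → MeasurableSpace Ω} {X : ℕ → Ω → EuclideanSpace ℝ (Fin d)} {I : ℕ → Ω → Fin ℓ}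
    {μ : Fin ℓ → Measure (EuclideanSpace ℝ (Fin d))} [∀ i, IsProbabilityMeasure (μ i)]
    (h : IsAdaptiveWalk F X I μ) (t : ℕ) (B : Set Ω) (hB : MeasurableSet[F t] B)
    (s : Set (EuclideanSpace ℝ (Fin d))) (hs : MeasurableSet s) :
    ℙ (B ∩ {ω | X (t + 1) ω - X t ω ∈ s}) = ∫⁻ ω in B, μ (I t ω) s := by
  have hX : ∀ t, Measurable (X t) := fun t => (h.adaptedX t).mono (h.le t) le_rfl
  have hI : ∀ t, Measurable (I t) := fun t => (h.adaptedI t).mono (h.le t) le_rfl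
  have hD : Measurable (fun ω => X (t + 1) ω - X t ω) := (hX _).sub (hX _)
  have hS : MeasurableSet {ω | X (t + 1) ω - X t ω ∈ s} := hD hs
  have hB' : MeasurableSet B := h.le t B hB
  have hf : (fun ω => s.indicator (fun _ => (1 : ℝ)) (X (t + 1) ω - X t ω))
      = {ω | X (t + 1) ω - X t ω ∈ s}.indicator (fun _ => (1:ℝ)) := by
    ext ω; simp [Set.indicator]
  have hIntg : Integrable (fun ω => s.indicator (fun _ => (1 : ℝ)) (X (t + 1) ω - X t ω)) (ℙ : Measure Ω) := by
    rw [hf]; exact (integrable_const _).indicator hS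
  have h1 := setIntegral_condExp (h.le t) hIntg hB
  rw [setIntegral_congr_ae hB' ((h.cond t s hs).mono (fun ω hω _ => hω)), hf,
    setIntegral_indicator hS] at h1
  simp only [integral_const, MeasurableSet.univ, measureReal_restrict_apply, Set.univ_inter, smul_eq_mul, mul_one] at h1
  rw [integral_toReal] at h1
  · rw [Measure.real, ENNReal.toReal_eq_toReal_iff' ?_ (measure_ne_top _ _)] at h1
    · exact h1.symm
    · refine ne_top_of_le_ne_top (measure_ne_top ℙ B) ?_
      calc ∫⁻ ω in B, μ (I t ω) s ≤ ∫⁻ ω in B, 1 := lintegral_mono (fun ω => prob_le_one)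
        _ = ℙ B := by simp
  · exact ((measurable_from_top (f := fun i => μ i s)).comp (hI t)).aemeasurable
  · exact Filter.Eventually.of_forall (fun ω => measure_lt_top _ _)

lemma aw_disint {Ω : Type} [MeasureSpace Ω] [IsProbabilityMeasure (ℙ : Measure Ω)] {d ℓ : ℕ}
    {F : ℕ → MeasurableSpace Ω} {X : ℕ → Ω → EuclideanSpace ℝ (Fin d)} {I : ℕ → Ω → Fin ℓ}
    {μ : Fin ℓ → Measure (EuclideanSpace ℝ (Fin d))} [∀ i, IsProbabilityMeasure (μ i)]
    (h : IsAdaptiveWalk F X I μ) (t : ℕ) {Z : Type} [MeasurableSpace Z] (z : Ω → Z)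
    (hz : Measurable[F t] z) (J : Z → Fin ℓ) (hJ : Measurable J) (hzJ : ∀ ω, J (z ω) = I t ω)
    (f : Z × EuclideanSpace ℝ (Fin d) → ENNReal) (hf : Measurable f) :
    ∫⁻ ω, f (z ω, X (t + 1) ω - X t ω) = ∫⁻ ω, ∫⁻ y, f (z ω, y) ∂(μ (I t ω)) := by
  have hX : ∀ t, Measurable (X t) := fun t => (h.adaptedX t).mono (h.le t) le_rfl
  have hz' : Measurable z := hz.mono (h.le t) le_rfl
  have hD : Measurable (fun ω => X (t + 1) ω - X t ω) := (hX _).sub (hX _)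
  let κ : ProbabilityTheory.Kernel Z (EuclideanSpace ℝ (Fin d)) :=
    (ProbabilityTheory.Kernel.ofFunOfCountable μ).comap J hJ
  have hκ : ∀ a, κ a = μ (J a) := fun a => rfl
  have : ProbabilityTheory.IsMarkovKernel κ := ⟨fun a => by rw [hκ]; infer_instance⟩
  have key : (ℙ : Measure Ω).map (fun ω => (z ω, X (t + 1) ω - X t ω))
      = ((ℙ : Measure Ω).map z).compProd κ := by
    have : IsFiniteMeasure ((ℙ : Measure Ω).map (fun ω => (z ω, X (t + 1) ω - X t ω))) := inferInstance
    apply Measure.ext_prod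
    intro A s hA hs
    rw [Measure.map_apply (hz'.prodMk hD) (hA.prod hs), Measure.compProd_apply_prod hA hs,
      setLIntegral_map hA (κ.measurable_coe hs) hz']
    simp only [hκ, hzJ]
    rw [← aw_rect h t _ (hz hA) s hs]
    rfl
  have e1 : ∫⁻ ω, f (z ω, X (t + 1) ω - X t ω)
      = ∫⁻ p, f p ∂((ℙ : Measure Ω).map (fun ω => (z ω, X (t + 1) ω - X t ω))) := by
    rw [lintegral_map hf (hz'.prodMk hD)]
  rw [e1, key, Measure.lintegral_compProd hf, lintegral_map (hf.lintegral_kernel_prod_right') hz']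
  simp only [hκ, hzJ]

/-- The clock. -/
def awClock {Ω : Type} {ℓ : ℕ} (I : ℕ → Ω → Fin ℓ) (N : Fin ℓ → ℕ) (t : ℕ) (ω : Ω) : ℕ :=
  ∑ j ∈ Finset.range t, N (I j ω)

lemma aw_step {Ω : Type} [MeasureSpace Ω] [IsProbabilityMeasure (ℙ : Measure Ω)] {d ℓ : ℕ}
    {F : ℕ → MeasurableSpace Ω} {X : ℕ → Ω → EuclideanSpace ℝ (Fin d)} {I : ℕ → Ω → Fin ℓ}
    {μ : Fin ℓ → Measure (EuclideanSpace ℝ (Fin d))} [∀ i, IsProbabilityMeasure (μ i)]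
    (h : IsAdaptiveWalk F X I μ) (N : Fin ℓ → ℕ) (hN : ∀ i, 1 ≤ N i)
    (H : ℕ → EuclideanSpace ℝ (Fin d) → ENNReal) (hH : ∀ s, Measurable (H s))
    (hstep : ∀ s i x, ∫⁻ y, H s (x + y) ∂(μ i) ≤ H (s + N i) x)
    (B : Set (EuclideanSpace ℝ (Fin d))) (hB : MeasurableSet B) (hB1 : ∀ x ∈ B, 1 ≤ H 0 x)
    (a n : ℕ) :
    ℙ {ω | awClock I N n ω = a ∧ X n ω ∈ B}
      + ∫⁻ ω, (if awClock I N (n + 1) ω ≤ a then H (a - awClock I N (n + 1) ω) (X (n + 1) ω) else 0)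
      ≤ ∫⁻ ω, (if awClock I N n ω ≤ a then H (a - awClock I N n ω) (X n ω) else 0) := by
  have hX : ∀ t, Measurable (X t) := fun t => (h.adaptedX t).mono (h.le t) le_rfl
  have hV : Measurable[F n] (awClock I N n) := by
    unfold awClock
    refine Finset.measurable_fun_sum _ (fun j hj => ?_)
    exact (measurable_from_top (f := N)).comp ((h.adaptedI j).mono (h.mono (Finset.mem_range.1 hj).le) le_rfl)
  have hV' : Measurable (awClock I N n) := hV.mono (h.le n) le_rfl
  let z : Ω → (EuclideanSpace ℝ (Fin d)) × (ℕ × Fin ℓ) := fun ω => (X n ω, (awClock I N n ω, I n ω))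
  have hz : Measurable[F n] z := (h.adaptedX n).prodMk (hV.prodMk (h.adaptedI n))
  have hHm : Measurable (fun p : EuclideanSpace ℝ (Fin d) × ℕ => H p.2 p.1) :=
    measurable_from_prod_countable_left (fun s => hH s)
  let f : ((EuclideanSpace ℝ (Fin d)) × (ℕ × Fin ℓ)) × EuclideanSpace ℝ (Fin d) → ENNReal :=
    fun p => if p.1.2.1 + N p.1.2.2 ≤ a then H (a - (p.1.2.1 + N p.1.2.2)) (p.1.1 + p.2) else 0
  have hNm : Measurable N := measurable_from_top
  have hf : Measurable f := by
    have hv : Measurable (fun p : ((EuclideanSpace ℝ (Fin d)) × (ℕ × Fin ℓ)) × EuclideanSpace ℝ (Fin d) =>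
        p.1.2.1 + N p.1.2.2) := by fun_prop
    apply Measurable.ite
    · exact measurableSet_le hv measurable_const
    · have hg : Measurable (fun p : ((EuclideanSpace ℝ (Fin d)) × (ℕ × Fin ℓ)) × EuclideanSpace ℝ (Fin d) =>
        ((p.1.1 + p.2, a - (p.1.2.1 + N p.1.2.2)) : EuclideanSpace ℝ (Fin d) × ℕ)) := by
        refine Measurable.prodMk (by fun_prop) ?_
        exact (measurable_from_top (f := fun v : ℕ => a - v)).comp hv
      exact hHm.comp hg
    · exact measurable_const
  have e := aw_disint h n z hz (fun p => p.2.2) (by fun_prop) (fun ω => rfl) f hf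
  have e2 : ∫⁻ ω, (if awClock I N (n + 1) ω ≤ a then H (a - awClock I N (n + 1) ω) (X (n + 1) ω) else 0)
      = ∫⁻ ω, f (z ω, X (n + 1) ω - X n ω) := by
    refine lintegral_congr (fun ω => ?_)
    have : awClock I N (n + 1) ω = awClock I N n ω + N (I n ω) := by
      unfold awClock; rw [Finset.sum_range_succ]
    simp only [f, z, this, add_sub_cancel]
  have hset : MeasurableSet {ω | awClock I N n ω = a ∧ X n ω ∈ B} :=
    (hV' (measurableSet_singleton a)).inter (hX n hB)
  rw [e2, e, ← lintegral_indicator_one hset, ← lintegral_add_left (measurable_one.indicator hset)]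
  refine lintegral_mono (fun ω => ?_)
  simp only [f, z]
  rcases lt_trichotomy (awClock I N n ω) a with hlt | heq | hgt
  · have h0 : ω ∉ {ω | awClock I N n ω = a ∧ X n ω ∈ B} := fun hh => hlt.ne hh.1
    rw [Set.indicator_of_notMem h0, zero_add, if_pos hlt.le]
    split_ifs with hc
    · refine (hstep _ _ _).trans (le_of_eq ?_)
      congr 1
      omega
    · simp
  · have hc : ¬ (awClock I N n ω + N (I n ω) ≤ a) := by have := hN (I n ω); omega
    simp only [hc, if_false, lintegral_zero, add_zero]
    rw [if_pos heq.le]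
    by_cases hm : X n ω ∈ B
    · rw [Set.indicator_of_mem (show ω ∈ {ω | awClock I N n ω = a ∧ X n ω ∈ B} from ⟨heq, hm⟩)]
      rw [heq, Nat.sub_self]; exact hB1 _ hm
    · rw [Set.indicator_of_notMem (fun hh => hm hh.2)]; exact zero_le
  · have hc : ¬ (awClock I N n ω + N (I n ω) ≤ a) := by omega
    have h0 : ω ∉ {ω | awClock I N n ω = a ∧ X n ω ∈ B} := fun hh => hgt.ne' hh.1
    simp only [hc, if_false, lintegral_zero, add_zero]
    rw [Set.indicator_of_notMem h0]; exact zero_le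

lemma aw_prob {Ω : Type} [MeasureSpace Ω] [IsProbabilityMeasure (ℙ : Measure Ω)] {d ℓ : ℕ}
    {F : ℕ → MeasurableSpace Ω} {X : ℕ → Ω → EuclideanSpace ℝ (Fin d)} {I : ℕ → Ω → Fin ℓ}
    {μ : Fin ℓ → Measure (EuclideanSpace ℝ (Fin d))} [∀ i, IsProbabilityMeasure (μ i)]
    (h : IsAdaptiveWalk F X I μ) (N : Fin ℓ → ℕ) (hN : ∀ i, 1 ≤ N i)
    (H : ℕ → EuclideanSpace ℝ (Fin d) → ENNReal) (hH : ∀ s, Measurable (H s))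
    (hstep : ∀ s i x, ∫⁻ y, H s (x + y) ∂(μ i) ≤ H (s + N i) x)
    (B : Set (EuclideanSpace ℝ (Fin d))) (hB : MeasurableSet B) (hB1 : ∀ x ∈ B, 1 ≤ H 0 x)
    (c : ℕ → ENNReal) (hc : ∀ s x, H s x ≤ c s) (T : ℝ) :
    ℙ {ω | ∃ t : ℕ, T < (t : ℝ) ∧ X t ω ∈ B} ≤ ∑' a : ℕ, if T < (a : ℝ) then c a else 0 := by
  have hone : ∀ a : ℕ, ℙ {ω | ∃ t : ℕ, awClock I N t ω = a ∧ X t ω ∈ B} ≤ c a := by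
    intro a
    have hsum : ∀ n, ∑ t ∈ Finset.range n, ℙ {ω | awClock I N t ω = a ∧ X t ω ∈ B}
        + ∫⁻ ω, (if awClock I N n ω ≤ a then H (a - awClock I N n ω) (X n ω) else 0) ≤ c a := by
      intro n
      induction n with
      | zero =>
        simp only [Finset.range_zero, Finset.sum_empty, zero_add, awClock, Nat.zero_le, if_true, Nat.sub_zero]
        calc ∫⁻ ω, H a (X 0 ω) ≤ ∫⁻ ω : Ω, c a := lintegral_mono (fun ω => hc _ _)
          _ = c a := by simp
      | succ n ih =>
        rw [Finset.sum_range_succ, add_assoc]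
        exact (add_le_add le_rfl (aw_step h N hN H hH hstep B hB hB1 a n)).trans ih
    have : {ω | ∃ t : ℕ, awClock I N t ω = a ∧ X t ω ∈ B} = ⋃ t : ℕ, {ω | awClock I N t ω = a ∧ X t ω ∈ B} := by
      ext ω; simp
    rw [this]
    refine (measure_iUnion_le _).trans ?_
    rw [ENNReal.tsum_eq_iSup_nat]
    exact iSup_le (fun n => le_self_add.trans (hsum n))
  have hsub : {ω | ∃ t : ℕ, T < (t : ℝ) ∧ X t ω ∈ B} ⊆
      ⋃ a : ℕ, {ω | T < (a : ℝ) ∧ ∃ t : ℕ, awClock I N t ω = a ∧ X t ω ∈ B} := by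
    rintro ω ⟨t, ht, hx⟩
    refine Set.mem_iUnion.2 ⟨awClock I N t ω, ?_, t, rfl, hx⟩
    refine ht.trans_le ?_
    have : t ≤ awClock I N t ω := by
      unfold awClock
      calc t = ∑ j ∈ Finset.range t, 1 := by simp
        _ ≤ _ := Finset.sum_le_sum (fun j _ => hN _)
    exact_mod_cast this
  refine (measure_mono hsub).trans ((measure_iUnion_le _).trans (ENNReal.tsum_le_tsum (fun a => ?_)))
  split_ifs with hT
  · simpa [hT] using hone a
  · simp [hT]

end Prob


section Moments

lemma aw_int_coord {d : ℕ} (μ : Measure (EuclideanSpace ℝ (Fin d)))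
    (hmom : Integrable (fun y => ‖y‖ ^ 2) μ) (a b : Fin d) :
    Integrable (fun y : EuclideanSpace ℝ (Fin d) => y a * y b) μ := by
  refine hmom.mono' (by fun_prop) (Filter.Eventually.of_forall fun y => ?_)
  have h1 : ‖y a‖ ≤ ‖y‖ := PiLp.norm_apply_le y a
  have h2 : ‖y b‖ ≤ ‖y‖ := PiLp.norm_apply_le y b
  rw [norm_mul, sq]
  gcongr

lemma aw_quad {d : ℕ} (μ : Measure (EuclideanSpace ℝ (Fin d)))
    (hmom : Integrable (fun y => ‖y‖ ^ 2) μ) (x : Fin d → ℝ) :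
    x ⬝ᵥ ((Matrix.of fun a b : Fin d => ∫ y, y a * y b ∂μ) *ᵥ x) =
      ∫ y, (x ⬝ᵥ (WithLp.ofLp y)) ^ 2 ∂μ := by
  have h : ∀ y : EuclideanSpace ℝ (Fin d), (x ⬝ᵥ (WithLp.ofLp y)) ^ 2 =
      ∑ a, ∑ b, (x a * x b) * (y a * y b) := by
    intro y
    simp only [dotProduct, sq, Finset.sum_mul_sum]
    refine Finset.sum_congr rfl fun a _ => Finset.sum_congr rfl fun b _ => by ring
  simp_rw [h]
  rw [integral_finsetSum _ (fun a _ => integrable_finsetSum _ fun b _ =>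
    (aw_int_coord μ hmom a b).const_mul _)]
  simp only [dotProduct, mulVec, Matrix.of_apply, Finset.mul_sum]
  refine Finset.sum_congr rfl fun a _ => ?_
  rw [integral_finsetSum _ (fun b _ => (aw_int_coord μ hmom a b).const_mul _)]
  refine Finset.sum_congr rfl fun b _ => ?_
  rw [integral_const_mul]; ring

lemma aw_posdef {d : ℕ} (μ : Measure (EuclideanSpace ℝ (Fin d)))
    (hmom : Integrable (fun y => ‖y‖ ^ 2) μ)
    (hcov : IsUnit (Matrix.of fun a b : Fin d => ∫ y, y a * y b ∂μ)) :
    (Matrix.of fun a b : Fin d => ∫ y, y a * y b ∂μ).PosDef := by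
  have hps : (Matrix.of fun a b : Fin d => ∫ y, y a * y b ∂μ).PosSemidef := by
    refine Matrix.PosSemidef.of_dotProduct_mulVec_nonneg ?_ fun x => ?_
    · ext a b
      simp [Matrix.conjTranspose_apply, mul_comm]
    · simp only [star_trivial]
      rw [aw_quad μ hmom x]
      exact integral_nonneg fun y => sq_nonneg _
  exact hps.posDef_iff_isUnit.2 hcov

lemma aw_quad_map {d : ℕ} (μ : Measure (EuclideanSpace ℝ (Fin d)))
    (hmom : Integrable (fun y => ‖y‖ ^ 2) μ) (S : Matrix (Fin d) (Fin d) ℝ) (x : Fin d → ℝ) :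
    ∫ y, (x ⬝ᵥ (S *ᵥ (WithLp.ofLp y))) ^ 2 ∂μ =
    x ⬝ᵥ ((S * (Matrix.of fun a b : Fin d => ∫ y, y a * y b ∂μ) * Sᵀ) *ᵥ x) := by
  have := aw_quad μ hmom (Sᵀ *ᵥ x)
  have h2 : ∀ z : Fin d → ℝ, (Sᵀ *ᵥ x) ⬝ᵥ z = x ⬝ᵥ (S *ᵥ z) := by
    intro z
    rw [Matrix.mulVec_transpose, Matrix.dotProduct_mulVec]
  simp only [h2] at this
  rw [← this]
  simp only [Matrix.mulVec_mulVec, Matrix.mul_assoc]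

lemma aw_trace_map {d : ℕ} (μ : Measure (EuclideanSpace ℝ (Fin d)))
    (hmom : Integrable (fun y => ‖y‖ ^ 2) μ) (S : Matrix (Fin d) (Fin d) ℝ) :
    ∫ y, ‖Matrix.toEuclideanCLM (n := Fin d) (𝕜 := ℝ) S y‖ ^ 2 ∂μ =
    (S * (Matrix.of fun a b : Fin d => ∫ y, y a * y b ∂μ) * Sᵀ).trace := by
  have h : ∀ y : EuclideanSpace ℝ (Fin d), ‖Matrix.toEuclideanCLM (n := Fin d) (𝕜 := ℝ) S y‖ ^ 2 =
      ∑ a, ((Pi.single a 1 : Fin d → ℝ) ⬝ᵥ (S *ᵥ (WithLp.ofLp y))) ^ 2 := by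
    intro y
    rw [EuclideanSpace.norm_sq_eq]
    refine Finset.sum_congr rfl fun a _ => ?_
    rw [single_dotProduct, one_mul, Real.norm_eq_abs, sq_abs]
    rfl
  have hSm : Integrable (fun y => ‖Matrix.toEuclideanCLM (n := Fin d) (𝕜 := ℝ) S y‖ ^ 2) μ := by
    refine (hmom.const_mul (‖Matrix.toEuclideanCLM (n := Fin d) (𝕜 := ℝ) S‖ ^ 2)).mono' (by fun_prop)
      (Filter.Eventually.of_forall fun y => ?_)
    rw [Real.norm_of_nonneg (by positivity), ← mul_pow]
    gcongr
    exact ContinuousLinearMap.le_opNorm _ _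
  have hIntg : ∀ a : Fin d, Integrable (fun y : EuclideanSpace ℝ (Fin d) =>
      ((Pi.single a 1 : Fin d → ℝ) ⬝ᵥ (S *ᵥ (WithLp.ofLp y))) ^ 2) μ := by
    intro a
    refine hSm.mono' ?_ (Filter.Eventually.of_forall fun y => ?_)
    · have : Continuous (fun y : EuclideanSpace ℝ (Fin d) =>
        ((Pi.single a 1 : Fin d → ℝ) ⬝ᵥ (S *ᵥ (WithLp.ofLp y))) ^ 2) := by
        simp only [single_dotProduct, one_mul, mulVec, dotProduct]
        fun_prop
      exact this.aestronglyMeasurable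
    · rw [Real.norm_of_nonneg (by positivity), h y]
      exact Finset.single_le_sum (f := fun a => ((Pi.single a 1 : Fin d → ℝ) ⬝ᵥ (S *ᵥ (WithLp.ofLp y))) ^ 2)
        (fun _ _ => sq_nonneg _) (Finset.mem_univ a)
  simp_rw [h]
  rw [integral_finsetSum _ (fun a _ => hIntg a)]
  simp only [Matrix.trace, Matrix.diag]
  refine Finset.sum_congr rfl fun a _ => ?_
  rw [aw_quad_map μ hmom, single_dotProduct, one_mul, Matrix.mulVec_single_one]
  rfl

end Moments


section Assembly

lemma aw_prep {d ℓ k : ℕ} (hk : 1 ≤ k) (hl0 : 0 < ℓ) (hkd : k < d) (hl : ℓ * (k - 1) ≤ d - 1)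
    (A : Fin ℓ → Matrix (Fin d) (Fin d) ℝ) (hA : ∀ i, (A i).PosDef) :
    ∃ κ : ℝ, (k : ℝ) < κ ∧ ∃ S : Matrix (Fin d) (Fin d) ℝ, ∃ N : Fin ℓ → ℕ, ∀ i, 1 ≤ N i ∧
      (∀ x : Fin d → ℝ, x ⬝ᵥ ((S * A i * Sᵀ) *ᵥ x) ≤ N i * (x ⬝ᵥ x)) ∧
      κ * N i ≤ (S * A i * Sᵀ).trace := by
  obtain ⟨S, L, hSL⟩ := aw_precond hk hl0 hkd hl A hA
  have : Nonempty (Fin ℓ) := ⟨⟨0, hl0⟩⟩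
  obtain ⟨j, hj⟩ := Finite.exists_min (fun i => (S * A i * Sᵀ).trace / L i)
  set κ0 : ℝ := (S * A j * Sᵀ).trace / L j with hκ0
  have hk0 : (k : ℝ) < κ0 := by
    rw [hκ0, lt_div_iff₀ (hSL j).1]; exact (hSL j).2.2
  have hκ0' : ∀ i, κ0 * L i ≤ (S * A i * Sᵀ).trace := fun i => by
    rw [← le_div_iff₀ (hSL i).1]; exact hj i
  set κ : ℝ := (k + κ0) / 2 with hκ
  have hkκ : (k : ℝ) < κ := by rw [hκ]; linarith
  have hκκ0 : κ < κ0 := by rw [hκ]; linarith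
  have hκpos : 0 < κ := lt_of_le_of_lt (Nat.cast_nonneg k) hkκ
  set c : ℝ := 1 + ∑ i, κ / ((κ0 - κ) * L i) with hc
  have hterm : ∀ i, 0 ≤ κ / ((κ0 - κ) * L i) := fun i =>
    div_nonneg hκpos.le (mul_nonneg (by linarith) (hSL i).1.le)
  have hc1 : 1 ≤ c := by
    have := Finset.sum_nonneg (s := Finset.univ) (fun i _ => hterm i)
    rw [hc]; linarith
  have hci : ∀ i, κ ≤ (κ0 - κ) * c * L i := by
    intro i
    have h1 : κ / ((κ0 - κ) * L i) ≤ c := by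
      have := Finset.single_le_sum (f := fun i => κ / ((κ0 - κ) * L i)) (fun i _ => hterm i)
        (Finset.mem_univ i)
      rw [hc]; linarith
    rw [div_le_iff₀ (mul_pos (by linarith) (hSL i).1)] at h1
    linarith
  have hmat : ∀ i, (√c • S) * A i * (√c • S)ᵀ = c • (S * A i * Sᵀ) := by
    intro i
    rw [Matrix.transpose_smul, Matrix.mul_smul, Matrix.smul_mul, Matrix.smul_mul, smul_smul,
      Real.mul_self_sqrt (by linarith)]
  refine ⟨κ, hkκ, √c • S, fun i => ⌈c * L i⌉₊, fun i => ⟨?_, fun x => ?_, ?_⟩⟩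
  · exact Nat.one_le_iff_ne_zero.2 (Nat.ceil_pos.2 (mul_pos (by linarith) (hSL i).1)).ne'
  · rw [hmat, Matrix.smul_mulVec, dotProduct_smul, smul_eq_mul]
    have hx : 0 ≤ x ⬝ᵥ x := by
      simp only [dotProduct]; exact Finset.sum_nonneg fun a _ => mul_self_nonneg _
    calc c * (x ⬝ᵥ ((S * A i * Sᵀ) *ᵥ x)) ≤ c * (L i * (x ⬝ᵥ x)) :=
          mul_le_mul_of_nonneg_left ((hSL i).2.1 x) (by linarith)
      _ = (c * L i) * (x ⬝ᵥ x) := by ring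
      _ ≤ _ := mul_le_mul_of_nonneg_right (Nat.le_ceil _) hx
  · rw [hmat, Matrix.trace_smul, smul_eq_mul]
    have h1 : ((⌈c * L i⌉₊ : ℕ) : ℝ) ≤ c * L i + 1 :=
      (Nat.ceil_lt_add_one (mul_nonneg (by linarith) (hSL i).1.le)).le
    calc κ * (⌈c * L i⌉₊ : ℕ) ≤ κ * (c * L i + 1) := mul_le_mul_of_nonneg_left h1 hκpos.le
      _ ≤ c * (κ0 * L i) := by linarith [hci i]
      _ ≤ _ := mul_le_mul_of_nonneg_left (hκ0' i) (by linarith)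

lemma aw_tsum (c ε p T : ℝ) (hc : 0 < c) (hε : 0 < ε) (hp : 0 ≤ p) (hT : 0 < T) :
    (∑' a : ℕ, if T < (a:ℝ) then (ENNReal.ofReal c)⁻¹ * ENNReal.ofReal (((a:ℝ) + 1) ^ (-(p + 1 + ε)))
      else 0) ≤
    ENNReal.ofReal ((c⁻¹ * ∑' a : ℕ, ((a:ℝ) + 1) ^ (-(1 + ε))) * T ^ (-p)) := by
  have hsum : Summable (fun a : ℕ => ((a:ℝ) + 1) ^ (-(1 + ε))) := by
    have h := (summable_nat_add_iff 1).2 (Real.summable_nat_rpow.2 (show -(1 + ε) < -1 by linarith))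
    simpa using h
  have hrw : ENNReal.ofReal ((c⁻¹ * ∑' a : ℕ, ((a:ℝ) + 1) ^ (-(1 + ε))) * T ^ (-p)) =
      ∑' a : ℕ, (ENNReal.ofReal c)⁻¹ * ENNReal.ofReal (T ^ (-p) * ((a:ℝ) + 1) ^ (-(1 + ε))) := by
    rw [ENNReal.tsum_mul_left, ← ENNReal.ofReal_tsum_of_nonneg (fun a => by positivity) (hsum.mul_left _),
      ← ENNReal.ofReal_inv_of_pos hc, ← ENNReal.ofReal_mul (by positivity), tsum_mul_left]
    congr 1; ring
  rw [hrw]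
  refine ENNReal.tsum_le_tsum fun a => ?_
  split_ifs with ha
  · gcongr
    rw [show -(p + 1 + ε) = -p + -(1 + ε) by ring, Real.rpow_add (by positivity)]
    refine mul_le_mul_of_nonneg_right ?_ (by positivity)
    exact Real.rpow_le_rpow_of_nonpos hT (by linarith) (by linarith)
  · exact zero_le

end Assembly

/-- quantitative transience. Let `k ≥ 2`, `d > k`, `ℓ·(k−1) ≤ d−1` and let
`μ 0, …, μ (ℓ−1)` be centered probability measures on `ℝᵈ` with finite second moments and
non-singular covariance matrices. Then there is `ε > 0` such that for every `R > 0` there is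
`C_R > 0` with: every adaptive random walk `X` using these measures satisfies, for all `T > 0`,
`P(∃ t > T, X t ∈ B(0,R)) ≤ C_R · T^{−(k−2)/2 − ε}`. -/
theorem stmt18 (k d ℓ : ℕ) (hk : 2 ≤ k) (hdk : k < d) (hℓ : 1 ≤ ℓ)
    (hℓk : ℓ * (k - 1) ≤ d - 1)
    (μ : Fin ℓ → Measure (EuclideanSpace ℝ (Fin d)))
    (hprob : ∀ i, IsProbabilityMeasure (μ i))
    (hcent : ∀ i, ∫ y, y ∂μ i = 0)
    (hmom : ∀ i, Integrable (fun y => ‖y‖ ^ 2) (μ i))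
    (hcov : ∀ i, IsUnit (Matrix.of fun a b : Fin d => ∫ y, y a * y b ∂μ i)) :
    ∃ ε > (0 : ℝ), ∀ R : ℝ, 0 < R → ∃ C > (0 : ℝ),
      ∀ (Ω : Type) (_ : MeasureSpace Ω),
        IsProbabilityMeasure (ℙ : Measure Ω) →
        ∀ (F : ℕ → MeasurableSpace Ω) (X : ℕ → Ω → EuclideanSpace ℝ (Fin d))
          (I : ℕ → Ω → Fin ℓ),
          IsAdaptiveWalk F X I μ →
          ∀ T : ℝ, 0 < T →
            ℙ {ω : Ω | ∃ t : ℕ, T < (t : ℝ) ∧ ‖X t ω‖ ≤ R}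
              ≤ ENNReal.ofReal (C * T ^ (-(((k : ℝ) - 2) / 2) - ε)) := by
  have hk2 : (2:ℝ) ≤ k := by exact_mod_cast hk
  obtain ⟨κ, hkκ, S, N, hSN⟩ := aw_prep (by omega) (by omega) hdk hℓk _
    (fun i => aw_posdef (μ i) (hmom i) (hcov i))
  set Φ := Matrix.toEuclideanCLM (n := Fin d) (𝕜 := ℝ) S with hΦ
  have hΦm : Measurable Φ := Φ.continuous.measurable
  set ν : Fin ℓ → Measure (EuclideanSpace ℝ (Fin d)) := fun i => (μ i).map Φ with hν
  have : ∀ i, IsProbabilityMeasure (ν i) := fun i =>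
    Measure.isProbabilityMeasure_map hΦm.aemeasurable
  have hint1 : ∀ i, Integrable (fun y : EuclideanSpace ℝ (Fin d) => y) (μ i) := by
    intro i
    refine ((hmom i).add (integrable_const (1:ℝ))).mono' (by fun_prop)
      (Filter.Eventually.of_forall fun y => ?_)
    simp only [Pi.add_apply]
    nlinarith [sq_nonneg (‖y‖ - 1), norm_nonneg y]
  have hcentν : ∀ i, ∫ y, y ∂(ν i) = 0 := by
    intro i
    simp only [hν]
    rw [integral_map hΦm.aemeasurable (by fun_prop), ContinuousLinearMap.integral_comp_comm _ (hint1 i),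
      hcent i, map_zero]
  have hmomν : ∀ i, Integrable (fun y => ‖y‖ ^ 2) (ν i) := by
    intro i
    simp only [hν]
    rw [integrable_map_measure (by fun_prop) hΦm.aemeasurable]
    refine ((hmom i).const_mul (‖Φ‖ ^ 2)).mono' ?_ (Filter.Eventually.of_forall fun y => ?_)
    · exact ((hΦm.norm).pow_const 2).aestronglyMeasurable
    · simp only [Function.comp]
      rw [Real.norm_of_nonneg (by positivity), ← mul_pow]
      gcongr
      exact ContinuousLinearMap.le_opNorm _ _
  have hqν : ∀ i x, ∫ y, (inner ℝ x y) ^ 2 ∂(ν i) ≤ N i * ‖x‖ ^ 2 := by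
    intro i x
    simp only [hν]
    rw [integral_map hΦm.aemeasurable (by fun_prop)]
    have h1 := aw_quad_map (μ i) (hmom i) S (WithLp.ofLp x)
    have h2 := (hSN i).2.1 (WithLp.ofLp x)
    have h3 : (WithLp.ofLp x) ⬝ᵥ (WithLp.ofLp x) = ‖x‖ ^ 2 := by
      rw [EuclideanSpace.norm_sq_eq]
      simp [dotProduct, sq]
    have h4 : ∀ y : EuclideanSpace ℝ (Fin d), inner ℝ x (Φ y) =
        (WithLp.ofLp x) ⬝ᵥ (S *ᵥ (WithLp.ofLp y)) := by
      intro y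
      rw [EuclideanSpace.inner_eq_star_dotProduct, dotProduct_comm]
      rfl
    simp only [h4]
    rw [h1, ← h3]
    exact h2
  have htrν : ∀ i, κ * N i ≤ ∫ y, ‖y‖ ^ 2 ∂(ν i) := by
    intro i
    simp only [hν]
    rw [integral_map hΦm.aemeasurable (by fun_prop), hΦ, aw_trace_map (μ i) (hmom i) S]
    exact (hSN i).2.2
  set ε : ℝ := (κ - k) / 6 with hε
  have hε0 : 0 < ε := by rw [hε]; linarith
  have hκε : κ = k + 6 * ε := by rw [hε]; ring
  obtain ⟨G, hGm, hGstep, hGle, hGlow⟩ := aw_super ν N (fun i => (hSN i).1) κ ε (by linarith) hε0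
    (by linarith) hcentν hmomν hqν htrν
  refine ⟨ε, hε0, fun R hR => ?_⟩
  obtain ⟨c, hc, hlow⟩ := hGlow (‖Φ‖ * R)
  set Z : ℝ := ∑' a : ℕ, ((a:ℝ) + 1) ^ (-(1 + ε)) with hZ
  have hZ0 : 0 ≤ Z := tsum_nonneg fun a => by positivity
  refine ⟨c⁻¹ * Z + 1, by positivity, fun Ω _ hP F X I hwalk T hT => ?_⟩
  have hmain := aw_prob hwalk N (fun i => (hSN i).1) (fun s x => (ENNReal.ofReal c)⁻¹ * G s (Φ x))
    (fun s => ((hGm s).comp hΦm).const_mul _) ?_ {x | ‖x‖ ≤ R}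
    (measurableSet_le measurable_norm measurable_const) ?_
    (fun a => (ENNReal.ofReal c)⁻¹ * ENNReal.ofReal (((a:ℝ) + 1) ^ (-((((k:ℝ) - 2) / 2 + ε) + 1 + ε)))) ?_ T
  · refine hmain.trans ((aw_tsum c ε (((k:ℝ) - 2) / 2 + ε) T hc hε0 (by linarith) hT).trans ?_)
    apply ENNReal.ofReal_le_ofReal
    rw [← hZ, show -(((k:ℝ) - 2) / 2) - ε = -(((k:ℝ) - 2) / 2 + ε) by ring]
    gcongr
    linarith
  · intro s i x
    have hm : Measurable (fun y => G s (Φ x + y)) := (hGm s).comp (measurable_const_add _)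
    have h := hGstep s i (Φ x)
    simp only [hν] at h
    rw [lintegral_map hm hΦm] at h
    simp only [map_add]
    rw [lintegral_const_mul (f := fun y => G s (Φ x + Φ y)) _ (hm.comp hΦm)]
    gcongr
  · intro x hx
    have h : ‖Φ x‖ ≤ ‖Φ‖ * R := (Φ.le_opNorm x).trans (by gcongr; exact hx)
    have h1 := hlow _ h
    have hc0 : ENNReal.ofReal c ≠ 0 := by simpa using hc
    calc (1:ENNReal) = (ENNReal.ofReal c)⁻¹ * ENNReal.ofReal c :=
          (ENNReal.inv_mul_cancel hc0 ENNReal.ofReal_ne_top).symm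
      _ ≤ _ := by gcongr
  · intro s x
    have h := hGle s (Φ x)
    rw [show -(κ / 2) + ε = -((((k:ℝ) - 2) / 2 + ε) + 1 + ε) by rw [hκε]; ring] at h
    gcongr
end
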